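/- arXiv:2204.11038 — 3 statements merged into one kernel-verified Lean document; each statement's English description precedes it below -/
import Mathlib

section
/- Suppose ♦ ≥ 0 and ρ* ≥ 0 satisfy ρ ≤ ρ*, ρ_G ≤ ρ*, |∫_U e^{F(u)} du − ∫_U e^{−‖D_G u‖²/2} du| ≤ ♦·Z, |∫_U g(u) e^{F(u)} du − ∫_U g(u) e^{−‖D_G u‖²/2} du| ≤ ♦·Z, and ♦ + ρ* ≤ 1/2. Then |(∫_{ℝ^p} g(u) e^{F(u)} du)/(∫_{ℝ^p} e^{F(u)} du) − Z⁻¹ ∫_{ℝ^p} g(u) e^{−‖D_G u‖²/2} du| ≤ 2(ρ* + ♦)/(1 − ρ* − ♦) ≤ 4(ρ* + ♦). -/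
open MeasureTheory Real

/-- `gaussNorm D u = ‖D u‖`, the Euclidean norm of the matrix `D` applied to `u`. -/
noncomputable def gaussNorm {p : ℕ} (D : Matrix (Fin p) (Fin p) ℝ)
    (u : EuclideanSpace ℝ (Fin p)) : ℝ :=
  ‖(Matrix.toEuclideanLin D) u‖

theorem gauss_integrable {p : ℕ} (D : Matrix (Fin p) (Fin p) ℝ) (hD : D.PosDef) :
    Integrable (fun u : EuclideanSpace ℝ (Fin p) => exp (-(gaussNorm D u) ^ 2 / 2)) := by
  have hinj : LinearMap.ker (Matrix.toEuclideanLin D) = ⊥ := by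
    rw [LinearMap.ker_eq_bot]
    intro x y hxy
    have h := Matrix.mulVec_injective_of_isUnit hD.isUnit
    apply WithLp.ofLp_injective
    apply h
    have := congrArg WithLp.ofLp hxy
    simpa [Matrix.toLpLin_apply] using this
  obtain ⟨K, hK, hL⟩ := LinearMap.exists_antilipschitzWith _ hinj
  have hK' : (0 : ℝ) < K := hK
  have hb : ∀ u : EuclideanSpace ℝ (Fin p), ‖u‖ ≤ K * gaussNorm D u := by
    intro u
    have := hL.le_mul_dist u 0
    simpa [gaussNorm] using this
  have hint : Integrable (fun u : EuclideanSpace ℝ (Fin p) =>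
      exp (-(1 / (2 * (K : ℝ) ^ 2)) * ‖u‖ ^ 2)) := by
    have h := GaussianFourier.integrable_cexp_neg_mul_sq_norm_add
      (b := ((1 / (2 * (K : ℝ) ^ 2) : ℝ) : ℂ)) (by rw [Complex.ofReal_re]; positivity) 0
      (0 : EuclideanSpace ℝ (Fin p))
    refine h.norm.congr (Filter.Eventually.of_forall fun u => ?_)
    simp only [Complex.norm_exp]
    congr 1
    simp only [zero_mul, add_zero]
    norm_cast
  have hcont : Continuous (fun u : EuclideanSpace ℝ (Fin p) => exp (-(gaussNorm D u) ^ 2 / 2)) := by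
    have : Continuous (Matrix.toEuclideanLin D) := LinearMap.continuous_of_finiteDimensional _
    unfold gaussNorm
    fun_prop
  refine hint.mono' hcont.aestronglyMeasurable (Filter.Eventually.of_forall fun u => ?_)
  rw [Real.norm_eq_abs, abs_of_pos (exp_pos _)]
  apply exp_le_exp.mpr
  have h1 : ‖u‖ ^ 2 ≤ (K : ℝ) ^ 2 * gaussNorm D u ^ 2 := by
    rw [← mul_pow]; exact pow_le_pow_left₀ (norm_nonneg _) (hb u) 2
  have h2 : 1 / (2 * (K : ℝ) ^ 2) * ‖u‖ ^ 2 ≤ gaussNorm D u ^ 2 / 2 := by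
    rw [div_mul_eq_mul_div, div_le_div_iff₀ (by positivity) (by norm_num)]
    nlinarith
  linarith

theorem ratio_bound (A Z a b ε : ℝ) (hZ : 0 < Z) (hε : ε ≤ 1 / 2)
    (hb0 : 0 ≤ b) (hbZ : b ≤ Z) (hA : |A - Z| ≤ ε * Z) (ha : |a - b| ≤ ε * Z) :
    |a / A - Z⁻¹ * b| ≤ 2 * ε / (1 - ε) := by
  have hε0 : 0 ≤ ε := by
    have := (abs_nonneg _).trans hA
    exact nonneg_of_mul_nonneg_left this hZ
  have hAl : (1 - ε) * Z ≤ A := by have := (abs_le.mp hA).1; linarith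
  have hApos : 0 < A := lt_of_lt_of_le (mul_pos (by linarith) hZ) hAl
  have e : a / A - Z⁻¹ * b = ((a - b) + (b / Z) * (Z - A)) / A := by
    field_simp; ring
  have hbz : |b / Z| ≤ 1 := by
    rw [abs_of_nonneg (by positivity)]; exact (div_le_one hZ).mpr hbZ
  have hn : |(a - b) + (b / Z) * (Z - A)| ≤ 2 * ε * Z := by
    refine (abs_add_le _ _).trans ?_
    rw [abs_mul, abs_sub_comm Z A]
    have := mul_le_mul hbz hA (abs_nonneg _) zero_le_one
    linarith
  rw [e, abs_div, abs_of_pos hApos, div_le_div_iff₀ hApos (by linarith)]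
  have h3 := mul_le_mul_of_nonneg_right hn (by linarith : 0 ≤ 1 - ε)
  have h4 := mul_le_mul_of_nonneg_left hAl (by linarith : 0 ≤ 2 * ε)
  linarith

theorem stmt_1 (p : ℕ)
    (DG : Matrix (Fin p) (Fin p) ℝ) (hDG : DG.PosDef)
    (F : EuclideanSpace ℝ (Fin p) → ℝ) (hFmeas : Measurable F)
    (hFint : Integrable (fun u => exp (F u)))
    (U : Set (EuclideanSpace ℝ (Fin p))) (hU : MeasurableSet U)
    (g : EuclideanSpace ℝ (Fin p) → ℝ) (hgmeas : Measurable g)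
    (hg : ∀ u, 0 ≤ g u ∧ g u ≤ 1)
    (Z ρ ρG dia ρstar : ℝ)
    (hZ : Z = ∫ u, exp (-(gaussNorm DG u) ^ 2 / 2))
    (hρ : ρ = Z⁻¹ * ∫ u in Uᶜ, exp (F u))
    (hρG : ρG = Z⁻¹ * ∫ u in Uᶜ, exp (-(gaussNorm DG u) ^ 2 / 2))
    (hdia : 0 ≤ dia) (hρstar : 0 ≤ ρstar)
    (hρle : ρ ≤ ρstar) (hρGle : ρG ≤ ρstar)
    (h1 : |(∫ u in U, exp (F u)) - ∫ u in U, exp (-(gaussNorm DG u) ^ 2 / 2)| ≤ dia * Z)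
    (h2 : |(∫ u in U, g u * exp (F u)) -
        ∫ u in U, g u * exp (-(gaussNorm DG u) ^ 2 / 2)| ≤ dia * Z)
    (hhalf : dia + ρstar ≤ 1 / 2) :
    |(∫ u, g u * exp (F u)) / (∫ u, exp (F u)) -
        Z⁻¹ * ∫ u, g u * exp (-(gaussNorm DG u) ^ 2 / 2)| ≤
      2 * (ρstar + dia) / (1 - ρstar - dia)
    ∧ 2 * (ρstar + dia) / (1 - ρstar - dia) ≤ 4 * (ρstar + dia) := by
  have hG := gauss_integrable DG hDG
  generalize hq : (fun u : EuclideanSpace ℝ (Fin p) => exp (-(gaussNorm DG u) ^ 2 / 2)) = q at hG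
  have hq' : ∀ u, exp (-(gaussNorm DG u) ^ 2 / 2) = q u := fun u => congrFun hq u
  have hZpos : 0 < Z := by
    rw [hZ]; exact integral_exp_pos (hq ▸ hG)
  have hqpos : ∀ u, 0 ≤ q u := fun u => by rw [← hq']; exact (exp_pos _).le
  simp only [hq'] at *
  have hFpos : ∀ u, 0 ≤ exp (F u) := fun u => (exp_pos _).le
  have key : ∀ f : EuclideanSpace ℝ (Fin p) → ℝ, Integrable f → (∀ u, 0 ≤ f u) →
      Integrable (fun u => g u * f u) ∧ (∀ S : Set (EuclideanSpace ℝ (Fin p)),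
        0 ≤ ∫ u in S, g u * f u) ∧ (∀ S : Set (EuclideanSpace ℝ (Fin p)),
        (∫ u in S, g u * f u) ≤ ∫ u in S, f u) ∧ 
        ∀ S : Set (EuclideanSpace ℝ (Fin p)), 0 ≤ ∫ u in S, f u := by
    intro f hf h0
    have hi : Integrable (fun u => g u * f u) := by
      refine hf.mono' (hgmeas.aestronglyMeasurable.mul hf.aestronglyMeasurable)
        (Filter.Eventually.of_forall fun u => ?_)
      rw [Real.norm_eq_abs, abs_of_nonneg (mul_nonneg (hg u).1 (h0 u))]
      exact mul_le_of_le_one_left (h0 u) (hg u).2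
    refine ⟨hi, fun S => integral_nonneg fun u => mul_nonneg (hg u).1 (h0 u), fun S => ?_,
      fun S => integral_nonneg h0⟩
    exact integral_mono hi.integrableOn hf.integrableOn
      fun u => mul_le_of_le_one_left (h0 u) (hg u).2
  obtain ⟨iF, nF, lF, pF⟩ := key _ hFint hFpos
  obtain ⟨iG, nG, lG, pG⟩ := key _ hG hqpos
  have hc : (∫ u in Uᶜ, exp (F u)) ≤ ρstar * Z := by
    rw [hρ, inv_mul_le_iff₀ hZpos] at hρle; linarith
  have hcG : (∫ u in Uᶜ, q u) ≤ ρstar * Z := by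
    rw [hρG, inv_mul_le_iff₀ hZpos] at hρGle; linarith
  have sA := integral_add_compl hU hFint
  have sZ := integral_add_compl hU hG
  have sa := integral_add_compl hU iF
  have sb := integral_add_compl hU iG
  rw [abs_le] at h1 h2
  have c1 := nF Uᶜ
  have c2 := lF Uᶜ
  have c3 := pF Uᶜ
  have d1 := nG Uᶜ
  have d2 := lG Uᶜ
  have d3 := pG Uᶜ
  have e1 := nG U
  have e2 := lG U
  constructor
  · have := ratio_bound (∫ u, exp (F u)) Z (∫ u, g u * exp (F u)) (∫ u, g u * q u)
      (ρstar + dia) hZpos (by linarith) (by linarith) (by linarith)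
      (by rw [abs_le]; constructor <;> linarith) (by rw [abs_le]; constructor <;> linarith)
    rwa [← sub_sub] at this
  · rw [div_le_iff₀ (by linarith)]
    nlinarith
end

section
/- Suppose sup_{|u| ≤ z} |δ₃(u)|/(D²u²/2) ≤ ω ≤ 1/3, that |δ₄(u)| ≤ 1 for |u| ≤ z, and that sup_{|u| ≤ z} 24|δ₄(u)|/(D²u⁴) ≤ κ₄. Then for every measurable even function g : ℝ → ℝ (g(u) = g(−u)) with |g(u)| ≤ 1 for all u, |∫_{−z}^{z} e^{f(x;u)} g(u) du − ∫_{−z}^{z} e^{−D²u²/2} g(u) du| ≤ ♦₄ · ∫_{ℝ} e^{−D²u²/2} du, where ♦₄ = {5κ₃²/(12(1−ω)^{7/2}) + κ₄/(4(1−ω)^{5/2})}·D⁻². -/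
open MeasureTheory Real

lemma aux_exp_pos (t : ℝ) (ht : 0 ≤ t) : exp t - 1 - t ≤ t ^ 2 / 2 * exp t := by
  have hd : ∀ s : ℝ, HasDerivAt (fun s : ℝ => (1 + s) * exp (-s) + s ^ 2 / 2)
      (s * (1 - exp (-s))) s := by
    intro s
    have h1 : HasDerivAt (fun s : ℝ => exp (-s)) (exp (-s) * (-1)) s :=
      (hasDerivAt_neg s).exp
    have h2 : HasDerivAt (fun s : ℝ => 1 + s) 1 s := (hasDerivAt_id s).const_add 1
    have h3 : HasDerivAt (fun s : ℝ => s ^ 2 / 2) ((2 : ℕ) * s ^ (2 - 1) / 2) s :=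
      (hasDerivAt_pow 2 s).div_const 2
    refine ((h2.mul h1).add h3).congr_deriv ?_
    push_cast
    ring
  have hm : MonotoneOn (fun s : ℝ => (1 + s) * exp (-s) + s ^ 2 / 2) (Set.Ici 0) := by
    refine monotoneOn_of_deriv_nonneg (convex_Ici 0)
      (fun s _ => (hd s).continuousAt.continuousWithinAt)
      (fun s _ => (hd s).differentiableAt.differentiableWithinAt) ?_
    intro s hs
    rw [interior_Ici] at hs
    have hs' : 0 < s := hs
    rw [(hd s).deriv]
    have : exp (-s) ≤ 1 := exp_le_one_iff.2 (by linarith)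
    exact mul_nonneg hs'.le (by linarith)
  have h := hm (Set.mem_Ici.2 le_rfl) (Set.mem_Ici.2 ht) ht
  simp only [neg_zero, exp_zero] at h
  have he : exp (-t) * exp t = 1 := by rw [← exp_add]; simp
  nlinarith [mul_le_mul_of_nonneg_right h (exp_pos t).le]

lemma aux_exp (a : ℝ) : |exp a - 1 - a| ≤ a ^ 2 / 2 * exp |a| := by
  rcases le_total 0 a with h | h
  · rw [abs_of_nonneg h, abs_of_nonneg (by linarith [add_one_le_exp a])]
    exact aux_exp_pos a h
  · have h1 := Complex.norm_exp_sub_sum_le_exp_norm_sub_sum (a : ℂ) 2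
    have h2 := aux_exp_pos |a| (abs_nonneg a)
    rw [sq_abs] at h2
    have h3 : ‖Complex.exp (a : ℂ) - ∑ m ∈ Finset.range 2, (a : ℂ) ^ m / (m.factorial : ℂ)‖
        = |exp a - 1 - a| := by
      rw [← Real.norm_eq_abs, ← Complex.norm_real]
      simp [Finset.sum_range_succ, sub_sub]
    rw [h3] at h1
    simp [Finset.sum_range_succ] at h1
    linarith

lemma aux_moment (b : ℝ) (hb : 0 < b) (k : ℕ) :
    Integrable (fun u : ℝ => u ^ (2 * k) * exp (-b * u ^ 2)) ∧
    ∫ u : ℝ, u ^ (2 * k) * exp (-b * u ^ 2) =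
      b ^ (-((k : ℝ) + 1 / 2)) * Gamma ((k : ℝ) + 1 / 2) := by
  constructor
  · have := integrable_rpow_mul_exp_neg_mul_sq hb (s := ((2 * k : ℕ) : ℝ))
      (lt_of_lt_of_le (by norm_num) (Nat.cast_nonneg _))
    simpa only [rpow_natCast] using this
  · have h1 := integral_comp_abs (f := fun u : ℝ => u ^ (2 * k) * exp (-b * u ^ 2))
    have h2 : (fun u : ℝ => |u| ^ (2 * k) * exp (-b * |u| ^ 2)) =
        fun u : ℝ => u ^ (2 * k) * exp (-b * u ^ 2) := by
      ext u
      rw [pow_mul, sq_abs, pow_mul]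
    simp only [h2] at h1
    rw [h1]
    have h3 := integral_rpow_mul_exp_neg_mul_rpow (p := ((2 : ℕ) : ℝ)) (q := ((2 * k : ℕ) : ℝ))
      (b := b) (by norm_num) (lt_of_lt_of_le (by norm_num) (Nat.cast_nonneg _)) hb
    simp only [rpow_natCast] at h3
    rw [h3]
    have e1 : (((2 * k : ℕ) : ℝ) + 1) / ((2 : ℕ) : ℝ) = (k : ℝ) + 1 / 2 := by
      push_cast; ring
    have e2 : -(((2 * k : ℕ) : ℝ) + 1) / ((2 : ℕ) : ℝ) = -((k : ℝ) + 1 / 2) := by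
      push_cast; ring
    rw [e1, e2]
    push_cast
    ring

lemma aux_moment_eq (D s : ℝ) (hD : 0 < D) (hs : 0 < s) (k : ℕ) :
    ∫ u : ℝ, u ^ (2 * k) * exp (-(s * (D ^ 2 / 2)) * u ^ 2) =
      Gamma ((k : ℝ) + 1 / 2) / Gamma (1 / 2) * (2 / D ^ 2) ^ k / s ^ ((k : ℝ) + 1 / 2) *
      ∫ u : ℝ, exp (-(D ^ 2 * u ^ 2) / 2) := by
  have hc : 0 < D ^ 2 / 2 := by positivity
  have h0 := (aux_moment (D ^ 2 / 2) hc 0).2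
  have h1 := (aux_moment (s * (D ^ 2 / 2)) (by positivity) k).2
  have e : (fun u : ℝ => u ^ (2 * 0) * exp (-(D ^ 2 / 2) * u ^ 2)) =
      fun u : ℝ => exp (-(D ^ 2 * u ^ 2) / 2) := by
    ext u
    rw [mul_zero, pow_zero, one_mul]
    congr 1
    ring
  simp only [e] at h0
  rw [h0, h1, mul_rpow hs.le hc.le, rpow_neg hs.le, neg_add, rpow_add hc, rpow_neg hc.le (k : ℝ),
    rpow_natCast]
  have hG : Gamma (1 / 2 : ℝ) ≠ 0 := (Gamma_pos_of_pos (by norm_num)).ne'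
  have hsn : s ^ ((k : ℝ) + 1 / 2) ≠ 0 := (rpow_pos_of_pos hs _).ne'
  have e3 : ((D ^ 2 / 2) ^ k)⁻¹ = (2 / D ^ 2) ^ k := by
    rw [← inv_pow, inv_div]
  rw [e3]
  simp only [Nat.cast_zero, zero_add, neg_add, neg_zero]
  field_simp

lemma aux_gamma2 : Gamma (((2 : ℕ) : ℝ) + 1 / 2) / Gamma (1 / 2) = 3 / 4 := by
  have hG : Gamma (1 / 2 : ℝ) ≠ 0 := (Gamma_pos_of_pos (by norm_num)).ne'
  have h1 := Gamma_add_one (s := (1 / 2 : ℝ)) (by norm_num)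
  have h2 := Gamma_add_one (s := (1 / 2 + 1 : ℝ)) (by norm_num)
  rw [show ((2 : ℕ) : ℝ) + 1 / 2 = 1 / 2 + 1 + 1 by norm_num, h2, h1]
  field_simp
  norm_num

lemma aux_gamma3 : Gamma (((3 : ℕ) : ℝ) + 1 / 2) / Gamma (1 / 2) = 15 / 8 := by
  have hG : Gamma (1 / 2 : ℝ) ≠ 0 := (Gamma_pos_of_pos (by norm_num)).ne'
  have h1 := Gamma_add_one (s := (1 / 2 : ℝ)) (by norm_num)
  have h2 := Gamma_add_one (s := (1 / 2 + 1 : ℝ)) (by norm_num)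
  have h3 := Gamma_add_one (s := (1 / 2 + 1 + 1 : ℝ)) (by norm_num)
  rw [show ((3 : ℕ) : ℝ) + 1 / 2 = 1 / 2 + 1 + 1 + 1 by norm_num, h3, h2, h1]
  field_simp
  norm_num

lemma aux_point (a c d w K : ℝ) (hacd : a - c = d) (ha : |a| ≤ w) (hd1 : |d| ≤ 1)
    (hdK : |d| ≤ K) : |exp a - 1 - c| ≤ exp w * (c ^ 2 + 2 * K) := by
  have h1 := aux_exp a
  have h2 : exp |a| ≤ exp w := exp_le_exp.2 ha
  have h3 : 1 ≤ exp w := one_le_exp ((abs_nonneg a).trans ha)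
  have h4 : |exp a - 1 - c| ≤ |exp a - 1 - a| + |d| := by
    rw [show exp a - 1 - c = (exp a - 1 - a) + d by rw [← hacd]; ring]
    exact abs_add_le _ _
  have h5 : d ^ 2 ≤ |d| := by
    rw [← sq_abs]; nlinarith [abs_nonneg d]
  have h6 : a ^ 2 / 2 ≤ c ^ 2 + K := by
    have : a = c + d := by linarith
    rw [this]; nlinarith [sq_nonneg (c - d)]
  have h7 : a ^ 2 / 2 * exp |a| ≤ (c ^ 2 + K) * exp w :=
    mul_le_mul h6 h2 (exp_pos _).le (by nlinarith [sq_nonneg a])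
  nlinarith [abs_nonneg d]

theorem stmt_5 (f : ℝ → ℝ) (hf : ContDiff ℝ 3 f) (x : ℝ) (D : ℝ) (hD : 0 < D)
    (hf'' : deriv (deriv f) x = -D ^ 2) (z : ℝ) (hz : 0 < z)
    (ω : ℝ) (hω : ω ≤ 1 / 3) (κ₃ κ₄ : ℝ) (hκ₄ : 0 ≤ κ₄)
    (hκ₃ : κ₃ = iteratedDeriv 3 f x / D ^ 2)
    (hδ3 : ∀ u : ℝ, |u| ≤ z →
      |f (x + u) - f x - deriv f x * u + D ^ 2 * u ^ 2 / 2| ≤ ω * (D ^ 2 * u ^ 2 / 2))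
    (hδ4le1 : ∀ u : ℝ, |u| ≤ z →
      |f (x + u) - f x - deriv f x * u + D ^ 2 * u ^ 2 / 2 -
        iteratedDeriv 3 f x * u ^ 3 / 6| ≤ 1)
    (hδ4 : ∀ u : ℝ, |u| ≤ z →
      24 * |f (x + u) - f x - deriv f x * u + D ^ 2 * u ^ 2 / 2 -
        iteratedDeriv 3 f x * u ^ 3 / 6| ≤ κ₄ * (D ^ 2 * u ^ 4))
    (g : ℝ → ℝ) (hgmeas : Measurable g) (hgeven : ∀ u, g (-u) = g u)
    (hg : ∀ u, |g u| ≤ 1) :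
    |(∫ u in (-z)..z, exp (f (x + u) - f x - deriv f x * u) * g u) -
        ∫ u in (-z)..z, exp (-(D ^ 2 * u ^ 2) / 2) * g u| ≤
      (5 * κ₃ ^ 2 / (12 * (1 - ω) ^ ((7 : ℝ) / 2)) +
        κ₄ / (4 * (1 - ω) ^ ((5 : ℝ) / 2))) / D ^ 2 *
        ∫ u : ℝ, exp (-(D ^ 2 * u ^ 2) / 2) := by
  set F := iteratedDeriv 3 f x with hF
  have hω0 : 0 ≤ ω := by
    have h := (abs_nonneg _).trans (hδ3 z (abs_of_pos hz).le)
    have : 0 < D ^ 2 * z ^ 2 / 2 := by positivity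
    exact nonneg_of_mul_nonneg_left h this
  have hs : 0 < 1 - ω := by linarith
  set b := (1 - ω) * (D ^ 2 / 2) with hb
  have hbpos : 0 < b := by positivity
  have hfc : Continuous f := hf.continuous
  have hgi : IntervalIntegrable g volume (-z) z := by
    rw [intervalIntegrable_iff]
    refine Measure.integrableOn_of_bounded (M := 1) ?_ hgmeas.aestronglyMeasurable ?_
    · simp [Set.uIoc]
    · exact Filter.Eventually.of_forall (fun u => by simpa using hg u)
  have hi1 : IntervalIntegrable
      (fun u => exp (f (x + u) - f x - deriv f x * u) * g u) volume (-z) z :=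
    hgi.continuousOn_mul (by fun_prop)
  have hi2 : IntervalIntegrable
      (fun u => exp (-(D ^ 2 * u ^ 2) / 2) * g u) volume (-z) z :=
    hgi.continuousOn_mul (by fun_prop)
  have hi3 : IntervalIntegrable
      (fun u => exp (-(D ^ 2 * u ^ 2) / 2) * (F * u ^ 3 / 6) * g u) volume (-z) z :=
    hgi.continuousOn_mul (by fun_prop)
  have hodd : ∫ u in (-z)..z, exp (-(D ^ 2 * u ^ 2) / 2) * (F * u ^ 3 / 6) * g u = 0 := by
    have h := intervalIntegral.integral_comp_neg (a := -z) (b := z)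
      (fun u => exp (-(D ^ 2 * u ^ 2) / 2) * (F * u ^ 3 / 6) * g u)
    have h2 : (fun u => exp (-(D ^ 2 * (-u) ^ 2) / 2) * (F * (-u) ^ 3 / 6) * g (-u)) =
        fun u => -(exp (-(D ^ 2 * u ^ 2) / 2) * (F * u ^ 3 / 6) * g u) := by
      ext u
      rw [hgeven, neg_sq]
      ring
    simp only [h2, neg_neg, intervalIntegral.integral_neg] at h
    linarith
  set P : ℝ → ℝ := fun u => F ^ 2 / 36 * (u ^ (2 * 3) * exp (-b * u ^ 2)) +
    κ₄ * D ^ 2 / 12 * (u ^ (2 * 2) * exp (-b * u ^ 2)) with hP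
  have hPi : Integrable P :=
    ((aux_moment b hbpos 3).1.const_mul _).add ((aux_moment b hbpos 2).1.const_mul _)
  have hP0 : ∀ u, 0 ≤ P u := by
    intro u
    have h1 : 0 ≤ u ^ (2 * 3) := by rw [pow_mul]; positivity
    have h2 : 0 ≤ u ^ (2 * 2) := by rw [pow_mul]; positivity
    simp only [hP]
    positivity
  have hPint : ∫ u, P u = (5 * κ₃ ^ 2 / (12 * (1 - ω) ^ ((7 : ℝ) / 2)) +
        κ₄ / (4 * (1 - ω) ^ ((5 : ℝ) / 2))) / D ^ 2 *
        ∫ u : ℝ, exp (-(D ^ 2 * u ^ 2) / 2) := by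
    simp only [hP]
    rw [integral_add ((aux_moment b hbpos 3).1.const_mul _) ((aux_moment b hbpos 2).1.const_mul _),
      integral_const_mul, integral_const_mul, hb, aux_moment_eq D (1 - ω) hD hs 3,
      aux_moment_eq D (1 - ω) hD hs 2, aux_gamma2, aux_gamma3, hκ₃,
      show ((3 : ℕ) : ℝ) + 1 / 2 = 7 / 2 by norm_num,
      show ((2 : ℕ) : ℝ) + 1 / 2 = 5 / 2 by norm_num]
    have h7 : (1 - ω) ^ ((7 : ℝ) / 2) ≠ 0 := (rpow_pos_of_pos hs _).ne'
    have h5 : (1 - ω) ^ ((5 : ℝ) / 2) ≠ 0 := (rpow_pos_of_pos hs _).ne'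
    generalize (1 - ω) ^ ((7 : ℝ) / 2) = A at *
    generalize (1 - ω) ^ ((5 : ℝ) / 2) = B at *
    field_simp
    ring
  rw [← hPint]
  have hkey : (∫ u in (-z)..z, exp (f (x + u) - f x - deriv f x * u) * g u) -
        ∫ u in (-z)..z, exp (-(D ^ 2 * u ^ 2) / 2) * g u =
      ∫ u in (-z)..z, (exp (f (x + u) - f x - deriv f x * u) * g u -
        exp (-(D ^ 2 * u ^ 2) / 2) * g u -
        exp (-(D ^ 2 * u ^ 2) / 2) * (F * u ^ 3 / 6) * g u) := by
    rw [intervalIntegral.integral_sub (hi1.sub hi2) hi3, intervalIntegral.integral_sub hi1 hi2,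
      hodd, sub_zero]
  rw [hkey, ← Real.norm_eq_abs]
  have hle : -z ≤ z := by linarith
  refine (intervalIntegral.norm_integral_le_of_norm_le hle (g := P) ?_
    hPi.intervalIntegrable).trans ?_
  · refine Filter.Eventually.of_forall (fun u hu => ?_)
    have huz : |u| ≤ z := abs_le.2 ⟨hu.1.le, hu.2⟩
    have hp := aux_point (f (x + u) - f x - deriv f x * u + D ^ 2 * u ^ 2 / 2)
      (F * u ^ 3 / 6) _ (ω * (D ^ 2 * u ^ 2 / 2)) (κ₄ * (D ^ 2 * u ^ 4) / 24) rfl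
      (hδ3 u huz) (hδ4le1 u huz) (by linarith [hδ4 u huz])
    set a := f (x + u) - f x - deriv f x * u + D ^ 2 * u ^ 2 / 2 with ha
    have e1 : exp (f (x + u) - f x - deriv f x * u) = exp (-(D ^ 2 * u ^ 2) / 2) * exp a := by
      rw [← exp_add, ha]; congr 1; ring
    have e2 : exp (-b * u ^ 2) =
        exp (-(D ^ 2 * u ^ 2) / 2) * exp (ω * (D ^ 2 * u ^ 2 / 2)) := by
      rw [← exp_add, hb]; congr 1; ring
    have e3 : exp (f (x + u) - f x - deriv f x * u) * g u -
        exp (-(D ^ 2 * u ^ 2) / 2) * g u -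
        exp (-(D ^ 2 * u ^ 2) / 2) * (F * u ^ 3 / 6) * g u =
        exp (-(D ^ 2 * u ^ 2) / 2) * (exp a - 1 - F * u ^ 3 / 6) * g u := by
      rw [e1]; ring
    rw [e3, Real.norm_eq_abs, abs_mul, abs_mul, abs_of_pos (exp_pos _)]
    calc _ ≤ exp (-(D ^ 2 * u ^ 2) / 2) * |exp a - 1 - F * u ^ 3 / 6| * 1 := by
          gcongr
          exact hg u
      _ ≤ exp (-(D ^ 2 * u ^ 2) / 2) * (exp (ω * (D ^ 2 * u ^ 2 / 2)) *
          ((F * u ^ 3 / 6) ^ 2 + 2 * (κ₄ * (D ^ 2 * u ^ 4) / 24))) := by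
          rw [mul_one]
          gcongr
      _ = P u := by
          simp only [hP]
          rw [e2]; ring
  · rw [intervalIntegral.integral_of_le hle]
    exact setIntegral_le_integral hPi (Filter.Eventually.of_forall hP0)
end

section
/- Suppose ω·p_G ≤ 2/3, the set U is centrally symmetric (−U = U), and there is a continuous symmetric trilinear form T on ℝ^p and a constant κ₄ ≥ 0 such that δ₄(u) := δ₃(u) − T(u,u,u)/6 satisfies |δ₄(u)| ≤ 1 and |δ₄(u)| ≤ κ₄‖D_V u‖⁴/24 for all u ∈ U. Then for every measurable g : ℝ^p → ℝ with |g(u)| ≤ 1 and g(u) = g(−u) for all u, |∫_U e^{F(u)} g(u) du − ∫_U e^{−‖D_G u‖²/2} g(u) du| ≤ ♦₄ · Z, where ♦₄ = (1/(16(1−ω)²)) · Z⁻¹ ∫_{ℝ^p} {T(u,u,u)² + 2κ₄‖D_V u‖⁴} e^{−‖D_G u‖²/2} du. -/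
open MeasureTheory Real Matrix

/-- Gaussian weight with diagonal precision. -/
noncomputable def gw {p : ℕ} (a : Fin p → ℝ) (x : EuclideanSpace ℝ (Fin p)) : ℝ :=
  exp (-(∑ i, a i * x i ^ 2) / 2)

lemma gw_cont {p : ℕ} (a : Fin p → ℝ) : Continuous (gw a) := by
  unfold gw; fun_prop

lemma gw_fderiv {p : ℕ} (a : Fin p → ℝ) (i : Fin p) (x : EuclideanSpace ℝ (Fin p)) :
    HasLineDerivAt ℝ (gw a) (-(a i * x i) * gw a x) x (EuclideanSpace.single i 1) := by
  unfold HasLineDerivAt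
  have h0 : HasDerivAt (fun t : ℝ => -(∑ j, a j * (x + t • EuclideanSpace.single i (1:ℝ)) j ^ 2) / 2)
      (-(∑ j, a j * (2 * x j * (if j = i then 1 else 0))) / 2) 0 := by
    apply HasDerivAt.div_const
    apply HasDerivAt.neg
    apply HasDerivAt.fun_sum
    intro j _
    apply HasDerivAt.const_mul
    have h1 : HasDerivAt (fun t : ℝ => (x + t • EuclideanSpace.single i (1:ℝ)) j)
        (if j = i then 1 else 0) 0 := by
      have := ((hasDerivAt_id (0:ℝ)).mul_const (if j = i then (1:ℝ) else 0)).const_add (x j)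
      simpa [PiLp.single_apply] using this
    have h2 := h1.fun_pow 2
    simpa using h2
  have h3 := h0.exp
  have h4 : ∑ j, a j * (2 * x j * (if j = i then 1 else 0)) = 2 * (a i * x i) := by
    simp; ring
  rw [h4] at h3
  have h5 : exp (-(∑ j, a j * (x + (0:ℝ) • EuclideanSpace.single i (1:ℝ)) j ^ 2) / 2) *
      (-(2 * (a i * x i)) / 2) = -(a i * x i) * gw a x := by
    simp [gw]
    ring
  rw [h5] at h3
  exact h3

lemma gauss_int {p : ℕ} {c : ℝ} (hc : 0 < c) :
    Integrable (fun x : EuclideanSpace ℝ (Fin p) => exp (-c * ‖x‖ ^ 2)) := by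
  by_contra h
  have := GaussianFourier.integral_rexp_neg_mul_sq_norm (V := EuclideanSpace ℝ (Fin p)) hc
  rw [integral_undef h] at this
  have h2 : 0 < (π / c) ^ (Module.finrank ℝ (EuclideanSpace ℝ (Fin p)) / 2 : ℝ) := by positivity
  linarith

lemma norm_pow_exp_int {p : ℕ} (n : ℕ) {c : ℝ} (hc : 0 < c) :
    Integrable (fun x : EuclideanSpace ℝ (Fin p) => ‖x‖ ^ n * exp (-c * ‖x‖ ^ 2)) := by
  -- ‖x‖^n ≤ K exp (c/2 ‖x‖^2)
  have hb : ∀ t : ℝ, 0 ≤ t → t ^ n ≤ (1 + n.factorial / (c/2) ^ n) * exp (c / 2 * t ^ 2) := by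
    intro t ht
    have h1 := Real.pow_div_factorial_le_exp (c / 2 * t ^ 2) (by positivity) n
    have h2 : 1 ≤ exp (c / 2 * t ^ 2) := Real.one_le_exp (by positivity)
    have h3 : t ^ n ≤ 1 + (t ^ 2) ^ n := by
      rw [← pow_mul, mul_comm, pow_mul]; nlinarith [sq_nonneg (t ^ n - 1)]
    have h4 : (t ^ 2) ^ n ≤ n.factorial / (c/2) ^ n * exp (c / 2 * t ^ 2) := by
      rw [mul_pow] at h1
      rw [div_mul_eq_mul_div, le_div_iff₀ (by positivity)]
      rw [div_le_iff₀ (by positivity)] at h1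
      linarith
    linarith
  refine ((gauss_int (p := p) (c := c / 2) (by positivity)).const_mul
    (1 + n.factorial / (c/2) ^ n)).mono' (by fun_prop) (ae_of_all _ fun x => ?_)
  rw [Real.norm_eq_abs, abs_of_nonneg (by positivity)]
  have := hb ‖x‖ (norm_nonneg x)
  calc _ ≤ (1 + n.factorial / (c/2) ^ n) * exp (c / 2 * ‖x‖ ^ 2) * exp (-c * ‖x‖ ^ 2) := by gcongr
    _ = _ := by rw [mul_assoc, ← Real.exp_add]; congr 2; ring

lemma abs_prod_le {p : ℕ} (l : List (Fin p)) (x : EuclideanSpace ℝ (Fin p)) :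
    |(l.map (fun i => x i)).prod| ≤ ‖x‖ ^ l.length := by
  induction l with
  | nil => simp
  | cons i l ih =>
    simp only [List.map_cons, List.prod_cons, abs_mul, List.length_cons, pow_succ']
    have : |x i| ≤ ‖x‖ := by simpa using PiLp.norm_apply_le x i
    gcongr

lemma gw_le {p : ℕ} {a : Fin p → ℝ} {c : ℝ} (ha : ∀ i, c ≤ a i)
    (x : EuclideanSpace ℝ (Fin p)) : gw a x ≤ exp (-(c / 2) * ‖x‖ ^ 2) := by
  unfold gw
  apply Real.exp_le_exp.2
  rw [EuclideanSpace.norm_sq_eq]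
  have : ∑ i, c * x i ^ 2 ≤ ∑ i, a i * x i ^ 2 :=
    Finset.sum_le_sum fun i _ => by gcongr; exact ha i
  rw [← Finset.mul_sum] at this
  simp only [Real.norm_eq_abs, sq_abs]
  linarith

lemma list_int {p : ℕ} {a : Fin p → ℝ} {c : ℝ} (hc : 0 < c) (ha : ∀ i, c ≤ a i)
    (l : List (Fin p)) :
    Integrable (fun x : EuclideanSpace ℝ (Fin p) => (l.map (fun i => x i)).prod * gw a x) := by
  refine (norm_pow_exp_int (p := p) l.length (c := c / 2) (by positivity)).mono'
    ?_ (ae_of_all _ fun x => ?_)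
  · apply Continuous.aestronglyMeasurable
    apply Continuous.mul _ (gw_cont a)
    apply continuous_list_prod
    intro i _
    fun_prop
  · rw [norm_mul, Real.norm_eq_abs, Real.norm_eq_abs, abs_of_nonneg (show 0 ≤ gw a x from Real.exp_nonneg _)]
    have h0 : 0 ≤ gw a x := Real.exp_nonneg _
    gcongr
    · exact abs_prod_le l x
    · exact gw_le ha x

/-- Stein identity. -/
lemma stein {p : ℕ} {a : Fin p → ℝ} (i : Fin p) (f f' : EuclideanSpace ℝ (Fin p) → ℝ)
    (h1 : Integrable (fun x => f' x * gw a x)) (h2 : Integrable (fun x => f x * (x i * gw a x)))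
    (h3 : Integrable (fun x => f x * gw a x))
    (hf : ∀ x, HasLineDerivAt ℝ f (f' x) x (EuclideanSpace.single i 1)) :
    a i * ∫ x, f x * (x i * gw a x) = ∫ x, f' x * gw a x := by
  have := integral_bilinear_hasLineDerivAt_right_eq_neg_left_of_integrable
    (μ := (volume : Measure (EuclideanSpace ℝ (Fin p))))
    (f := f) (f' := f') (g := gw a) (g' := fun x => -(a i * x i) * gw a x)
    (v := EuclideanSpace.single i 1)
    (B := ContinuousLinearMap.mul ℝ ℝ) (by simpa using h1)
    (by
      have := h2.const_mul (-(a i))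
      refine this.congr (ae_of_all _ fun x => ?_)
      simp; ring) (by simpa using h3) (fun x _ => hf x) (fun x _ => gw_fderiv a i x)
  simp only [ContinuousLinearMap.mul_apply'] at this
  rw [← integral_const_mul]
  rw [← neg_eq_iff_eq_neg, ← integral_neg] at this
  rw [← this]
  congr 1; ext x; ring

lemma list_deriv {p : ℕ} (i j : Fin p) (x : EuclideanSpace ℝ (Fin p)) :
    HasLineDerivAt ℝ (fun x : EuclideanSpace ℝ (Fin p) => x j) (if i = j then 1 else 0) x
      (EuclideanSpace.single i 1) := by
  unfold HasLineDerivAt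
  have := ((hasDerivAt_id (0:ℝ)).mul_const (if i = j then (1:ℝ) else 0)).const_add (x j)
  simpa [PiLp.single_apply, eq_comm] using this

lemma hld_mul {p : ℕ} {f g : EuclideanSpace ℝ (Fin p) → ℝ} {f' g' : ℝ} {x v : EuclideanSpace ℝ (Fin p)}
    (hf : HasLineDerivAt ℝ f f' x v) (hg : HasLineDerivAt ℝ g g' x v) :
    HasLineDerivAt ℝ (fun x => f x * g x) (f' * g x + f x * g') x v := by
  unfold HasLineDerivAt at *
  have := HasDerivAt.fun_mul hf hg
  simpa using this


lemma wick2 {p : ℕ} {a : Fin p → ℝ} {c : ℝ} (hc : 0 < c) (ha : ∀ i, c ≤ a i)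
    (i j : Fin p) :
    ∫ x : EuclideanSpace ℝ (Fin p), x i * x j * gw a x =
      (a i)⁻¹ * ((if i = j then 1 else 0) * ∫ x, gw a x) := by
  have hi : a i ≠ 0 := (hc.trans_le (ha i)).ne'
  have := stein (a := a) i (fun x => x j) (fun _ => if i = j then 1 else 0)
    (by simpa using (list_int hc ha []).const_mul (if i = j then (1:ℝ) else 0))
    (by simpa [mul_assoc] using (list_int hc ha [j, i]))
    (by simpa [mul_assoc] using (list_int hc ha [j]))
    (fun x => list_deriv i j x)
  rw [integral_const_mul] at this
  rw [← this, inv_mul_cancel_left₀ hi]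
  congr 1; ext x; ring

lemma wick4 {p : ℕ} {a : Fin p → ℝ} {c : ℝ} (hc : 0 < c) (ha : ∀ i, c ≤ a i)
    (i j k l : Fin p) :
    ∫ x : EuclideanSpace ℝ (Fin p), x i * x j * x k * x l * gw a x =
      (a i)⁻¹ * ((if i = j then 1 else 0) * (∫ x, x k * x l * gw a x)
        + (if i = k then 1 else 0) * (∫ x, x j * x l * gw a x)
        + (if i = l then 1 else 0) * (∫ x, x j * x k * gw a x)) := by
  have hi : a i ≠ 0 := (hc.trans_le (ha i)).ne'
  have I1 : ∀ d : ℝ, Integrable fun x : EuclideanSpace ℝ (Fin p) => d * (x k * x l * gw a x) :=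
    fun d => by simpa [mul_assoc] using (list_int hc ha [k,l]).const_mul d
  have I2 : ∀ d : ℝ, Integrable fun x : EuclideanSpace ℝ (Fin p) => d * (x j * x l * gw a x) :=
    fun d => by simpa [mul_assoc] using (list_int hc ha [j,l]).const_mul d
  have I3 : ∀ d : ℝ, Integrable fun x : EuclideanSpace ℝ (Fin p) => d * (x j * x k * gw a x) :=
    fun d => by simpa [mul_assoc] using (list_int hc ha [j,k]).const_mul d
  have heq : ∀ x : EuclideanSpace ℝ (Fin p),
      (((if i = j then 1 else 0) * x k + x j * (if i = k then 1 else 0)) * x l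
        + x j * x k * (if i = l then 1 else 0)) * gw a x =
      (if i = j then 1 else 0) * (x k * x l * gw a x)
        + (if i = k then 1 else 0) * (x j * x l * gw a x)
        + (if i = l then 1 else 0) * (x j * x k * gw a x) := fun x => by ring
  have := stein (a := a) i (fun x => x j * x k * x l) _
    (by simp only [heq]; exact ((I1 _).add (I2 _)).add (I3 _))
    (by simpa [mul_assoc] using (list_int hc ha [j, k, l, i]))
    (by simpa [mul_assoc] using (list_int hc ha [j, k, l]))
    (fun x => hld_mul (hld_mul (list_deriv i j x) (list_deriv i k x)) (list_deriv i l x))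
  simp only [heq] at this
  rw [integral_add ((I1 _).fun_add (I2 _)) (I3 _), integral_add (I1 _) (I2 _)] at this
  simp only [integral_const_mul] at this
  rw [← this, inv_mul_cancel_left₀ hi]
  congr 1; ext x; ring

lemma wick6 {p : ℕ} {a : Fin p → ℝ} {c : ℝ} (hc : 0 < c) (ha : ∀ i, c ≤ a i)
    (i j k l m n : Fin p) :
    ∫ x : EuclideanSpace ℝ (Fin p), x i * x j * x k * x l * x m * x n * gw a x =
      (a i)⁻¹ * ((if i = j then 1 else 0) * (∫ x, x k * x l * x m * x n * gw a x)
        + (if i = k then 1 else 0) * (∫ x, x j * x l * x m * x n * gw a x)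
        + (if i = l then 1 else 0) * (∫ x, x j * x k * x m * x n * gw a x)
        + (if i = m then 1 else 0) * (∫ x, x j * x k * x l * x n * gw a x)
        + (if i = n then 1 else 0) * (∫ x, x j * x k * x l * x m * gw a x)) := by
  have hi : a i ≠ 0 := (hc.trans_le (ha i)).ne'
  have I : ∀ (q r s t : Fin p) (d : ℝ), Integrable fun x : EuclideanSpace ℝ (Fin p) =>
      d * (x q * x r * x s * x t * gw a x) :=
    fun q r s t d => by simpa [mul_assoc] using (list_int hc ha [q,r,s,t]).const_mul d
  have heq : ∀ x : EuclideanSpace ℝ (Fin p),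
      (((((if i = j then 1 else 0) * x k + x j * (if i = k then 1 else 0)) * x l
        + x j * x k * (if i = l then 1 else 0)) * x m
        + x j * x k * x l * (if i = m then 1 else 0)) * x n
        + x j * x k * x l * x m * (if i = n then 1 else 0)) * gw a x =
      (if i = j then 1 else 0) * (x k * x l * x m * x n * gw a x)
        + (if i = k then 1 else 0) * (x j * x l * x m * x n * gw a x)
        + (if i = l then 1 else 0) * (x j * x k * x m * x n * gw a x)
        + (if i = m then 1 else 0) * (x j * x k * x l * x n * gw a x)
        + (if i = n then 1 else 0) * (x j * x k * x l * x m * gw a x) := fun x => by ring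
  have := stein (a := a) i (fun x => x j * x k * x l * x m * x n) _
    (by simp only [heq]
        exact ((((I _ _ _ _ _).add (I _ _ _ _ _)).add (I _ _ _ _ _)).add (I _ _ _ _ _)).add
          (I _ _ _ _ _))
    (by simpa [mul_assoc] using (list_int hc ha [j, k, l, m, n, i]))
    (by simpa [mul_assoc] using (list_int hc ha [j, k, l, m, n]))
    (fun x => hld_mul (hld_mul (hld_mul (hld_mul (list_deriv i j x) (list_deriv i k x))
      (list_deriv i l x)) (list_deriv i m x)) (list_deriv i n x))
  simp only [heq] at this
  rw [integral_add ((((I _ _ _ _ _).fun_add (I _ _ _ _ _)).fun_add (I _ _ _ _ _)).fun_add (I _ _ _ _ _))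
      (I _ _ _ _ _), integral_add (((I _ _ _ _ _).fun_add (I _ _ _ _ _)).fun_add (I _ _ _ _ _))
      (I _ _ _ _ _), integral_add ((I _ _ _ _ _).fun_add (I _ _ _ _ _)) (I _ _ _ _ _),
      integral_add (I _ _ _ _ _) (I _ _ _ _ _)] at this
  simp only [integral_const_mul] at this
  rw [← this, inv_mul_cancel_left₀ hi]
  congr 1; ext x; ring

lemma quart_eq {p : ℕ} {a : Fin p → ℝ} {c : ℝ} (hc : 0 < c) (ha : ∀ i, c ≤ a i)
    (lam : Fin p → ℝ) :
    Integrable (fun x : EuclideanSpace ℝ (Fin p) => (∑ i, lam i * x i ^ 2) ^ 2 * gw a x) ∧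
    ∫ x : EuclideanSpace ℝ (Fin p), (∑ i, lam i * x i ^ 2) ^ 2 * gw a x =
      (∫ x, gw a x) * ((∑ i, lam i * (a i)⁻¹) ^ 2 + 2 * ∑ i, (lam i * (a i)⁻¹) ^ 2) := by
  have h : ∀ x : EuclideanSpace ℝ (Fin p), (∑ i, lam i * x i ^ 2) ^ 2 * gw a x =
      ∑ i, ∑ k, lam i * lam k * (x i * x i * x k * x k * gw a x) := by
    intro x
    rw [sq, Finset.sum_mul_sum, Finset.sum_mul]
    refine Finset.sum_congr rfl fun i _ => ?_
    rw [Finset.sum_mul]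
    refine Finset.sum_congr rfl fun k _ => ?_
    ring
  have I : ∀ i k, Integrable (fun x : EuclideanSpace ℝ (Fin p) =>
      lam i * lam k * (x i * x i * x k * x k * gw a x)) := fun i k => by
    simpa [mul_assoc] using (list_int hc ha [i,i,k,k]).const_mul (lam i * lam k)
  simp only [h]
  refine ⟨integrable_finsetSum _ fun i _ => integrable_finsetSum _ fun k _ => I i k, ?_⟩
  rw [integral_finsetSum _ fun i _ => integrable_finsetSum _ fun k _ => I i k]
  simp only [integral_finsetSum _ fun k _ => I _ k, integral_const_mul, wick4 hc ha, wick2 hc ha]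
  generalize (∫ x, gw a x) = W
  rw [sq, Finset.sum_mul_sum]
  have h2 : ∑ i, (lam i * (a i)⁻¹) ^ 2 = ∑ i, ∑ k, if i = k then (lam i * (a i)⁻¹) ^ 2 else 0 := by
    simp
  rw [h2, Finset.mul_sum, ← Finset.sum_add_distrib, Finset.mul_sum]
  refine Finset.sum_congr rfl fun i _ => ?_
  rw [Finset.mul_sum, ← Finset.sum_add_distrib, Finset.mul_sum]
  refine Finset.sum_congr rfl fun k _ => ?_
  by_cases hik : i = k
  · subst hik; simp; ring
  · simp [hik]; ring

/-- Contraction of six indices. -/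
lemma contract {p : ℕ} (s : Fin p → ℝ) (W : ℝ)
    (t : Fin p → Fin p → Fin p → ℝ) (t1 : ∀ i j k, t i j k = t j i k)
    (t2 : ∀ i j k, t i j k = t i k j) (D2 : Fin p → Fin p → ℝ)
    (hD2 : ∀ i j, D2 i j = s i * ((if i = j then 1 else 0) * W))
    (D4 : Fin p → Fin p → Fin p → Fin p → ℝ)
    (hD4 : ∀ i j k l, D4 i j k l = s i * ((if i = j then 1 else 0) * D2 k l
      + (if i = k then 1 else 0) * D2 j l + (if i = l then 1 else 0) * D2 j k)) :
    ∑ i, ∑ j, ∑ k, ∑ l, ∑ m, ∑ n, t i j k * t l m n * (s i * (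
        (if i = j then 1 else 0) * D4 k l m n + (if i = k then 1 else 0) * D4 j l m n
        + (if i = l then 1 else 0) * D4 j k m n + (if i = m then 1 else 0) * D4 j k l n
        + (if i = n then 1 else 0) * D4 j k l m)) =
    W * (6 * (∑ i, ∑ j, ∑ k, s i * s j * s k * t i j k ^ 2) + 
        9 * ∑ k, s k * (∑ i, s i * t i i k) ^ 2) := by
  set b : Fin p → ℝ := fun k => ∑ i, s i * t i i k with hb
  have t3 : ∀ i k, t i k i = t i i k := fun i k => (t2 i k i)
  have t4 : ∀ i k, t k i i = t i i k := fun i k => by rw [t1 k i i, t2 i k i]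
  have R1 : ∀ k, ∑ l, ∑ m, ∑ n, t l m n * D4 k l m n = W * (3 * s k * b k) := by
    intro k
    simp only [hD4, hD2, mul_add, Finset.sum_add_distrib]
    simp only [mul_ite, ite_mul, mul_zero, zero_mul, one_mul,
      Finset.sum_ite_irrel, Finset.sum_const_zero, Finset.sum_ite_eq,
      Finset.mem_univ, if_true, t3, hb, Finset.mul_sum]
    simp only [← Finset.sum_add_distrib]
    refine Finset.sum_congr rfl fun i _ => ?_
    rw [t4 i k]
    ring
  have R0 : ∀ i j k, ∑ m, ∑ n, t i m n * D4 j k m n =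
      W * ((if j = k then s j * b i else 0) + 2 * s j * s k * t i j k) := by
    intro i j k
    simp only [hD4, hD2, mul_add, Finset.sum_add_distrib]
    simp only [mul_ite, ite_mul, mul_zero, zero_mul, one_mul,
      Finset.sum_ite_irrel, Finset.sum_const_zero, Finset.sum_ite_eq,
      Finset.mem_univ, if_true, t3, hb, Finset.mul_sum]
    rw [t2 i k j]
    have : (if j = k then ∑ m, t i m m * (s j * (s m * W)) else 0) =
      (if j = k then ∑ m, W * (s j * (s m * t m m i)) else 0) := by
      congr 1
      exact Finset.sum_congr rfl fun m _ => by rw [t4 m i]; ring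
    rw [this]
    ring
  have R2 : ∀ i j k, ∑ l, ∑ m, ∑ n, t l m n * ((if i = l then 1 else 0) * D4 j k m n) =
      W * ((if j = k then s j * b i else 0) + 2 * s j * s k * t i j k) := by
    intro i j k
    rw [← R0]
    simp only [mul_ite, ite_mul, mul_zero, zero_mul, one_mul,
      Finset.sum_ite_irrel, Finset.sum_const_zero, Finset.sum_ite_eq,
      Finset.mem_univ, if_true]
  have R3 : ∀ i j k, ∑ l, ∑ m, ∑ n, t l m n * ((if i = m then 1 else 0) * D4 j k l n) =
      W * ((if j = k then s j * b i else 0) + 2 * s j * s k * t i j k) := by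
    intro i j k
    rw [← R0]
    simp only [mul_ite, ite_mul, mul_zero, zero_mul, one_mul,
      Finset.sum_ite_irrel, Finset.sum_const_zero, Finset.sum_ite_eq,
      Finset.mem_univ, if_true]
    refine Finset.sum_congr rfl fun m _ => Finset.sum_congr rfl fun n _ => ?_
    rw [t1 m i n]
  have R4 : ∀ i j k, ∑ l, ∑ m, ∑ n, t l m n * ((if i = n then 1 else 0) * D4 j k l m) =
      W * ((if j = k then s j * b i else 0) + 2 * s j * s k * t i j k) := by
    intro i j k
    rw [← R0]
    simp only [mul_ite, ite_mul, mul_zero, zero_mul, one_mul,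
      Finset.sum_ite_irrel, Finset.sum_const_zero, Finset.sum_ite_eq,
      Finset.mem_univ, if_true]
    refine Finset.sum_congr rfl fun m _ => Finset.sum_congr rfl fun n _ => ?_
    rw [t2 m n i, t1 m i n]
  have key : ∀ i j k, ∑ l, ∑ m, ∑ n, t i j k * t l m n * (s i * (
        (if i = j then 1 else 0) * D4 k l m n + (if i = k then 1 else 0) * D4 j l m n
        + (if i = l then 1 else 0) * D4 j k m n + (if i = m then 1 else 0) * D4 j k l n
        + (if i = n then 1 else 0) * D4 j k l m)) =
      W * ((if i = j then 3 * (s k * b k * (s i * t i j k)) else 0) +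
        (if i = k then 3 * (s j * b j * (s i * t i j k)) else 0) +
        (if j = k then 3 * (s i * b i * (s j * t i j k)) else 0) +
        6 * (s i * s j * s k * t i j k ^ 2)) := by
    intro i j k
    have : ∀ l m n, t i j k * t l m n * (s i * (
        (if i = j then 1 else 0) * D4 k l m n + (if i = k then 1 else 0) * D4 j l m n
        + (if i = l then 1 else 0) * D4 j k m n + (if i = m then 1 else 0) * D4 j k l n
        + (if i = n then 1 else 0) * D4 j k l m)) =
        (t i j k * s i) * ((if i = j then 1 else 0) * (t l m n * D4 k l m n) + 
        (if i = k then 1 else 0) * (t l m n * D4 j l m n)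
        + t l m n * ((if i = l then 1 else 0) * D4 j k m n)
        + t l m n * ((if i = m then 1 else 0) * D4 j k l n)
        + t l m n * ((if i = n then 1 else 0) * D4 j k l m)) := by intros; ring
    simp only [this, ← Finset.mul_sum, Finset.sum_add_distrib, R1, R2, R3, R4]
    split_ifs <;> ring
  simp only [key, ← Finset.mul_sum]
  congr 1
  simp only [Finset.sum_add_distrib, ← Finset.mul_sum]
  have F1 : ∑ i, ∑ j, ∑ k, (if i = j then 3 * (s k * b k * (s i * t i j k)) else 0) =
      3 * ∑ k, s k * b k ^ 2 := by
    simp only [Finset.sum_ite_irrel, Finset.sum_const_zero, Finset.sum_ite_eq, Finset.mem_univ,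
      if_true]
    rw [Finset.sum_comm, Finset.mul_sum]
    refine Finset.sum_congr rfl fun k _ => ?_
    rw [← Finset.mul_sum, ← Finset.mul_sum]; ring
  have F2 : ∑ i, ∑ j, ∑ k, (if i = k then 3 * (s j * b j * (s i * t i j k)) else 0) =
      3 * ∑ k, s k * b k ^ 2 := by
    simp only [Finset.sum_ite_eq, Finset.mem_univ, if_true, t3]
    rw [Finset.sum_comm, Finset.mul_sum]
    refine Finset.sum_congr rfl fun k _ => ?_
    rw [← Finset.mul_sum, ← Finset.mul_sum]; ring
  have F3 : ∑ i, ∑ j, ∑ k, (if j = k then 3 * (s i * b i * (s j * t i j k)) else 0) =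
      3 * ∑ k, s k * b k ^ 2 := by
    simp only [Finset.sum_ite_eq, Finset.mem_univ, if_true]
    rw [Finset.mul_sum]
    refine Finset.sum_congr rfl fun k _ => ?_
    have hbk : ∑ x, s x * t k x x = b k := Finset.sum_congr rfl fun m _ => by rw [t4 m k]
    rw [← Finset.mul_sum, ← Finset.mul_sum, hbk]; ring
  rw [F1, F2, F3]
  ring

lemma cub_eq {p : ℕ} {a : Fin p → ℝ} {c : ℝ} (hc : 0 < c) (ha : ∀ i, c ≤ a i)
    (t : Fin p → Fin p → Fin p → ℝ) (t1 : ∀ i j k, t i j k = t j i k)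
    (t2 : ∀ i j k, t i j k = t i k j) :
    Integrable (fun x : EuclideanSpace ℝ (Fin p) =>
      (∑ i, ∑ j, ∑ k, t i j k * (x i * x j * x k)) ^ 2 * gw a x) ∧
    ∫ x : EuclideanSpace ℝ (Fin p), (∑ i, ∑ j, ∑ k, t i j k * (x i * x j * x k)) ^ 2 * gw a x =
      (∫ x, gw a x) * (6 * (∑ i, ∑ j, ∑ k, (a i)⁻¹ * (a j)⁻¹ * (a k)⁻¹ * t i j k ^ 2) + 
        9 * ∑ k, (a k)⁻¹ * (∑ i, (a i)⁻¹ * t i i k) ^ 2) := by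
  have h : ∀ x : EuclideanSpace ℝ (Fin p),
      (∑ i, ∑ j, ∑ k, t i j k * (x i * x j * x k)) ^ 2 * gw a x =
      ∑ i, ∑ j, ∑ k, ∑ l, ∑ m, ∑ n, t i j k * t l m n *
        (x i * x j * x k * x l * x m * x n * gw a x) := by
    intro x
    rw [sq, mul_assoc]
    simp only [Finset.sum_mul]
    refine Finset.sum_congr rfl fun i _ => Finset.sum_congr rfl fun j _ =>
      Finset.sum_congr rfl fun k _ => ?_
    simp only [Finset.mul_sum]
    refine Finset.sum_congr rfl fun l _ => Finset.sum_congr rfl fun m _ =>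
      Finset.sum_congr rfl fun n _ => ?_
    ring
  have I : ∀ i j k l m n, Integrable (fun x : EuclideanSpace ℝ (Fin p) =>
      t i j k * t l m n * (x i * x j * x k * x l * x m * x n * gw a x)) := fun i j k l m n => by
    simpa [mul_assoc] using (list_int hc ha [i,j,k,l,m,n]).const_mul (t i j k * t l m n)
  have I1 : ∀ i j k l m, Integrable (fun x : EuclideanSpace ℝ (Fin p) => ∑ n,
      t i j k * t l m n * (x i * x j * x k * x l * x m * x n * gw a x)) := fun i j k l m =>
    integrable_finsetSum _ fun _ _ => I _ _ _ _ _ _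
  have I2 : ∀ i j k l, Integrable (fun x : EuclideanSpace ℝ (Fin p) => ∑ m, ∑ n,
      t i j k * t l m n * (x i * x j * x k * x l * x m * x n * gw a x)) := fun i j k l =>
    integrable_finsetSum _ fun _ _ => I1 _ _ _ _ _
  have I3 : ∀ i j k, Integrable (fun x : EuclideanSpace ℝ (Fin p) => ∑ l, ∑ m, ∑ n,
      t i j k * t l m n * (x i * x j * x k * x l * x m * x n * gw a x)) := fun i j k =>
    integrable_finsetSum _ fun _ _ => I2 _ _ _ _
  have I4 : ∀ i j, Integrable (fun x : EuclideanSpace ℝ (Fin p) => ∑ k, ∑ l, ∑ m, ∑ n,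
      t i j k * t l m n * (x i * x j * x k * x l * x m * x n * gw a x)) := fun i j =>
    integrable_finsetSum _ fun _ _ => I3 _ _ _
  have I5 : ∀ i, Integrable (fun x : EuclideanSpace ℝ (Fin p) => ∑ j, ∑ k, ∑ l, ∑ m, ∑ n,
      t i j k * t l m n * (x i * x j * x k * x l * x m * x n * gw a x)) := fun i =>
    integrable_finsetSum _ fun _ _ => I4 _ _
  simp only [h]
  refine ⟨integrable_finsetSum _ fun i _ => I5 i, ?_⟩
  rw [integral_finsetSum _ fun i _ => I5 i]
  simp only [integral_finsetSum _ fun _ _ => I4 _ _, integral_finsetSum _ fun _ _ => I3 _ _ _,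
    integral_finsetSum _ fun _ _ => I2 _ _ _ _, integral_finsetSum _ fun _ _ => I1 _ _ _ _ _,
    integral_finsetSum _ fun _ _ => I _ _ _ _ _ _, integral_const_mul, wick6 hc ha]
  exact contract (fun i => (a i)⁻¹) (∫ x, gw a x) t t1 t2
    (fun i j => ∫ x : EuclideanSpace ℝ (Fin p), x i * x j * gw a x)
    (fun i j => wick2 hc ha i j)
    (fun i j k l => ∫ x : EuclideanSpace ℝ (Fin p), x i * x j * x k * x l * gw a x)
    (fun i j k l => wick4 hc ha i j k l)

lemma gw_integral {p : ℕ} (a : Fin p → ℝ) :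
    ∫ x : EuclideanSpace ℝ (Fin p), gw a x = ∏ i, √(π / (a i / 2)) := by
  have h := (PiLp.volume_preserving_toLp (Fin p)).integral_comp
    (MeasurableEquiv.toLp 2 (Fin p → ℝ)).measurableEmbedding (gw a)
  rw [← h]
  have h2 : ∀ x : Fin p → ℝ, gw a (WithLp.toLp 2 x) = ∏ i, exp (-(a i / 2) * x i ^ 2) := by
    intro x
    rw [← Real.exp_sum, gw, neg_div, Finset.sum_div, ← Finset.sum_neg_distrib]
    congr 1
    exact Finset.sum_congr rfl fun i _ => by simp; ring
  simp only [h2]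
  rw [integral_fintype_prod_volume_eq_prod (fun i (y : ℝ) => exp (-(a i / 2) * y ^ 2))]
  simp only [integral_gaussian]

lemma gw_compare {p : ℕ} (x : Fin p → ℝ) (h0 : ∀ i, 0 ≤ x i) (h1 : ∀ i, x i ≤ 1 / 3)
    (hs : ∑ i, x i ≤ 2 / 3) :
    ∫ u : EuclideanSpace ℝ (Fin p), gw (fun i => 1 - x i) u ≤
      5 / 3 * ∫ u : EuclideanSpace ℝ (Fin p), gw (fun _ => 1) u := by
  rw [gw_integral, gw_integral]
  have h2 : ∀ i, √(π / ((1 - x i) / 2)) ≤ exp (3 / 4 * x i) * √(π / (1 / 2)) := by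
    intro i
    have ha := h0 i
    have hb := h1 i
    apply Real.sqrt_le_iff.2
    refine ⟨by positivity, ?_⟩
    rw [mul_pow, Real.sq_sqrt (by positivity), ← Real.exp_nat_mul]
    have h3 : 1 / (1 - x i) ≤ exp (3 / 2 * x i) := by
      have h4 := Real.add_one_le_exp (3 / 2 * x i)
      refine le_trans ?_ h4
      rw [div_le_iff₀ (by linarith)]
      nlinarith
    have h5 : π / ((1 - x i) / 2) = 1 / (1 - x i) * (π / (1 / 2)) := by
      have : 1 - x i ≠ 0 := by linarith
      field_simp
    rw [h5]
    have h6 : ((2 : ℕ) : ℝ) * (3 / 4 * x i) = 3 / 2 * x i := by push_cast; ring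
    rw [h6]
    gcongr
  calc ∏ i, √(π / ((1 - x i) / 2)) ≤ ∏ i, (exp (3 / 4 * x i) * √(π / (1 / 2))) :=
        Finset.prod_le_prod (fun i _ => Real.sqrt_nonneg _) fun i _ => h2 i
    _ = exp (3 / 4 * ∑ i, x i) * ∏ i : Fin p, √(π / (1 / 2)) := by
        rw [Finset.prod_mul_distrib, ← Real.exp_sum, Finset.mul_sum]
    _ ≤ _ := by
        have h7 : exp (3 / 4 * ∑ i, x i) ≤ 5 / 3 := by
          have h8 : exp (3 / 4 * ∑ i, x i) ≤ exp (1 / 2) := Real.exp_le_exp.2 (by linarith)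
          have h9 : exp (1 / 2) ^ 2 = exp 1 := by
            rw [← Real.exp_nat_mul]; norm_num
          have h10 := Real.exp_one_lt_d9
          have h11 := Real.exp_pos (1 / 2)
          nlinarith
        gcongr

lemma comp4 {p : ℕ} (w : ℝ) (hw0 : 0 ≤ w) (hw : w ≤ 1 / 3) (lam : Fin p → ℝ)
    (h0 : ∀ i, 0 ≤ lam i) (h1 : ∀ i, lam i ≤ 1) (hs : w * ∑ i, lam i ≤ 2 / 3) :
    ∫ x : EuclideanSpace ℝ (Fin p), (∑ i, lam i * x i ^ 2) ^ 2 * gw (fun i => 1 - w * lam i) x ≤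
      5 / 3 * (1 - w)⁻¹ ^ 2 *
    ∫ x : EuclideanSpace ℝ (Fin p), (∑ i, lam i * x i ^ 2) ^ 2 * gw (fun _ => 1) x := by
  have hx1 : ∀ i, w * lam i ≤ w := fun i => by nlinarith [h1 i]
  rw [(quart_eq (a := fun i => 1 - w * lam i) (c := 1 / 2) (by norm_num)
    (fun i => by linarith [hx1 i]) lam).2,
    (quart_eq (a := fun _ => 1) (c := 1 / 2) (by norm_num) (fun i => by norm_num) lam).2]
  have hW := gw_compare (fun i => w * lam i) (fun i => mul_nonneg hw0 (h0 i))
    (fun i => (hx1 i).trans hw) (by rw [← Finset.mul_sum]; exact hs)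
  have hW0 : 0 ≤ ∫ u : EuclideanSpace ℝ (Fin p), gw (fun _ => 1) u :=
    integral_nonneg fun _ => Real.exp_nonneg _
  have hS : ∀ i, lam i * (1 - w * lam i)⁻¹ ≤ (1 - w)⁻¹ * lam i := fun i => by
    rw [mul_comm]
    have h2 : (1 - w * lam i)⁻¹ ≤ (1 - w)⁻¹ := inv_anti₀ (by linarith) (by linarith [hx1 i])
    exact mul_le_mul_of_nonneg_right h2 (h0 i)
  have hP : ∀ i, 0 ≤ lam i * (1 - w * lam i)⁻¹ := fun i =>
    mul_nonneg (h0 i) (inv_nonneg.2 (by linarith [hx1 i]))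
  have hA : (∑ i, lam i * (1 - w * lam i)⁻¹) ^ 2 ≤ (1 - w)⁻¹ ^ 2 * (∑ i, lam i * (1:ℝ)⁻¹) ^ 2 := by
    rw [← mul_pow]
    apply pow_le_pow_left₀ (Finset.sum_nonneg fun i _ => hP i)
    rw [Finset.mul_sum]
    exact Finset.sum_le_sum fun i _ => by simpa using hS i
  have hB : ∑ i, (lam i * (1 - w * lam i)⁻¹) ^ 2 ≤ (1 - w)⁻¹ ^ 2 * ∑ i, (lam i * (1:ℝ)⁻¹) ^ 2 := by
    rw [Finset.mul_sum]
    refine Finset.sum_le_sum fun i _ => ?_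
    rw [← mul_pow]
    apply pow_le_pow_left₀ (hP i)
    simpa using hS i
  calc _ ≤ (5 / 3 * ∫ u : EuclideanSpace ℝ (Fin p), gw (fun _ => 1) u) *
        ((1 - w)⁻¹ ^ 2 * (∑ i, lam i * (1:ℝ)⁻¹) ^ 2 +
          2 * ((1 - w)⁻¹ ^ 2 * ∑ i, (lam i * (1:ℝ)⁻¹) ^ 2)) := by
        apply mul_le_mul hW _ _ (by positivity)
        · linarith
        · have := Finset.sum_nonneg fun i (_ : i ∈ Finset.univ) => sq_nonneg (lam i * (1 - w * lam i)⁻¹)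
          positivity
    _ = _ := by ring

lemma comp6 {p : ℕ} (w : ℝ) (hw0 : 0 ≤ w) (hw : w ≤ 1 / 3) (lam : Fin p → ℝ)
    (h0 : ∀ i, 0 ≤ lam i) (h1 : ∀ i, lam i ≤ 1) (hs : w * ∑ i, lam i ≤ 2 / 3)
    (t : Fin p → Fin p → Fin p → ℝ) (t1 : ∀ i j k, t i j k = t j i k)
    (t2 : ∀ i j k, t i j k = t i k j) :
    ∫ x : EuclideanSpace ℝ (Fin p), (∑ i, ∑ j, ∑ k, t i j k * (x i * x j * x k)) ^ 2 *
        gw (fun i => 1 - w * lam i) x ≤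
      25 / 6 * (1 - w)⁻¹ ^ 2 *
    ∫ x : EuclideanSpace ℝ (Fin p), (∑ i, ∑ j, ∑ k, t i j k * (x i * x j * x k)) ^ 2 *
      gw (fun _ => 1) x := by
  have hx1 : ∀ i, w * lam i ≤ w := fun i => by nlinarith [h1 i]
  have hx0 : ∀ i, 0 ≤ w * lam i := fun i => mul_nonneg hw0 (h0 i)
  rw [(cub_eq (a := fun i => 1 - w * lam i) (c := 1 / 2) (by norm_num)
    (fun i => by linarith [hx1 i]) t t1 t2).2,
    (cub_eq (a := fun _ => 1) (c := 1 / 2) (by norm_num) (fun i => by norm_num) t t1 t2).2]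
  have hW := gw_compare (fun i => w * lam i) hx0
    (fun i => (hx1 i).trans hw) (by rw [← Finset.mul_sum]; exact hs)
  have hW0 : 0 ≤ ∫ u : EuclideanSpace ℝ (Fin p), gw (fun _ => 1) u :=
    integral_nonneg fun _ => Real.exp_nonneg _
  set S := (1 - w)⁻¹ with hSdef
  set s : Fin p → ℝ := fun i => (1 - w * lam i)⁻¹ with hsdef
  have hs0 : ∀ i, 0 ≤ s i := fun i => inv_nonneg.2 (by linarith [hx1 i])
  have hsS : ∀ i, s i ≤ S := fun i => inv_anti₀ (by linarith) (by linarith [hx1 i])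
  have hS1 : 1 ≤ S := (one_le_inv₀ (by linarith)).2 (by linarith)
  have hS2 : S ≤ 3 / 2 := by
    rw [hSdef]; exact inv_le_of_inv_le₀ (by norm_num) (by norm_num; linarith)
  -- y i = s i - 1
  have hy0 : ∀ i, 0 ≤ s i - 1 := fun i => by
    have := (one_le_inv₀ (a := 1 - w * lam i) (by linarith [hx1 i])).2 (by linarith [hx0 i])
    simp only [hsdef]; linarith
  have hy1 : ∀ i, s i - 1 ≤ 1 / 2 := fun i => by linarith [hsS i]
  have hy2 : ∀ i, s i - 1 ≤ 3 / 2 * (w * lam i) := fun i => by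
    have h3 : s i * (1 - w * lam i) = 1 := inv_mul_cancel₀ (by linarith [hx1 i])
    nlinarith [hx0 i, hx1 i, hsS i]
  have hyy : ∑ i, (s i - 1) ^ 2 ≤ 1 / 2 := by
    calc ∑ i, (s i - 1) ^ 2 ≤ ∑ i, 1 / 2 * (3 / 2 * (w * lam i)) :=
          Finset.sum_le_sum fun i _ => by nlinarith [hy0 i, hy1 i, hy2 i]
      _ = 3 / 4 * (w * ∑ i, lam i) := by
          simp only [Finset.mul_sum]; exact Finset.sum_congr rfl fun i _ => by ring
      _ ≤ 1 / 2 := by linarith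
  set N := ∑ i, ∑ j, ∑ k, t i j k ^ 2 with hN
  set b : Fin p → ℝ := fun k => ∑ i, t i i k with hb
  have hN0 : 0 ≤ N := Finset.sum_nonneg fun i _ => Finset.sum_nonneg fun j _ =>
    Finset.sum_nonneg fun k _ => sq_nonneg _
  have hb0 : 0 ≤ ∑ k, b k ^ 2 := Finset.sum_nonneg fun k _ => sq_nonneg _
  have hA : ∑ i, ∑ j, ∑ k, s i * s j * s k * t i j k ^ 2 ≤ S ^ 3 * N := by
    simp only [hN, Finset.mul_sum]
    refine Finset.sum_le_sum fun i _ => Finset.sum_le_sum fun j _ =>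
      Finset.sum_le_sum fun k _ => ?_
    have : s i * s j * s k ≤ S * S * S := by
      have := hs0 i; have := hs0 j; have := hs0 k
      have := hsS i; have := hsS j; have := hsS k
      gcongr
    calc _ ≤ S * S * S * t i j k ^ 2 := by gcongr
      _ = _ := by ring
  have hB1 : ∀ k, (∑ i, s i * t i i k) ^ 2 ≤ 2 * b k ^ 2 + ∑ i, t i i k ^ 2 := by
    intro k
    have e : ∑ i, s i * t i i k = b k + ∑ i, (s i - 1) * t i i k := by
      simp only [hb, ← Finset.sum_add_distrib]
      exact Finset.sum_congr rfl fun i _ => by ring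
    have cs := Finset.sum_mul_sq_le_sq_mul_sq Finset.univ (fun i => s i - 1) (fun i => t i i k)
    have hn : 0 ≤ ∑ i, t i i k ^ 2 := Finset.sum_nonneg fun i _ => sq_nonneg _
    have cs2 : (∑ i, (s i - 1) * t i i k) ^ 2 ≤ 1 / 2 * ∑ i, t i i k ^ 2 :=
      cs.trans (by gcongr)
    rw [e]
    nlinarith [sq_nonneg (b k - ∑ i, (s i - 1) * t i i k)]
  have hNk : ∑ k, ∑ i, t i i k ^ 2 ≤ N := by
    rw [Finset.sum_comm, hN]
    refine Finset.sum_le_sum fun i _ => ?_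
    exact Finset.single_le_sum (f := fun j => ∑ k, t i j k ^ 2)
      (fun j _ => Finset.sum_nonneg fun k _ => sq_nonneg _) (Finset.mem_univ i)
  have hB : ∑ k, s k * (∑ i, s i * t i i k) ^ 2 ≤ S * (2 * ∑ k, b k ^ 2 + N) := by
    calc _ ≤ ∑ k, S * (2 * b k ^ 2 + ∑ i, t i i k ^ 2) := by
          refine Finset.sum_le_sum fun k _ => ?_
          exact mul_le_mul (hsS k) (hB1 k) (sq_nonneg _) (by linarith)
      _ = S * (2 * ∑ k, b k ^ 2 + ∑ k, ∑ i, t i i k ^ 2) := by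
          rw [← Finset.mul_sum, Finset.sum_add_distrib, ← Finset.mul_sum]
      _ ≤ _ := by gcongr
  have hC : 6 * (∑ i, ∑ j, ∑ k, s i * s j * s k * t i j k ^ 2) +
      9 * ∑ k, s k * (∑ i, s i * t i i k) ^ 2 ≤
      5 / 2 * S ^ 2 * (6 * N + 9 * ∑ k, b k ^ 2) := by
    have e1 : 6 * S ^ 3 + 9 * S ≤ 15 * S ^ 2 := by
      nlinarith [mul_nonneg (mul_nonneg (sub_nonneg.2 hS1) (sub_nonneg.2 hS2)) (by linarith : 0 ≤ S)]
    have e2 : 18 * S ≤ 45 / 2 * S ^ 2 := by nlinarith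
    have e3 := mul_le_mul_of_nonneg_right e1 hN0
    have e4 := mul_le_mul_of_nonneg_right e2 hb0
    nlinarith
  have hC0 : 0 ≤ 6 * (∑ i, ∑ j, ∑ k, s i * s j * s k * t i j k ^ 2) +
      9 * ∑ k, s k * (∑ i, s i * t i i k) ^ 2 := by
    have : 0 ≤ ∑ i, ∑ j, ∑ k, s i * s j * s k * t i j k ^ 2 :=
      Finset.sum_nonneg fun i _ => Finset.sum_nonneg fun j _ => Finset.sum_nonneg fun k _ =>
        mul_nonneg (mul_nonneg (mul_nonneg (hs0 i) (hs0 j)) (hs0 k)) (sq_nonneg _)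
    have : 0 ≤ ∑ k, s k * (∑ i, s i * t i i k) ^ 2 :=
      Finset.sum_nonneg fun k _ => mul_nonneg (hs0 k) (sq_nonneg _)
    positivity
  have hR : 6 * (∑ i, ∑ j, ∑ k, (1:ℝ)⁻¹ * (1:ℝ)⁻¹ * (1:ℝ)⁻¹ * t i j k ^ 2) +
      9 * ∑ k, (1:ℝ)⁻¹ * (∑ i, (1:ℝ)⁻¹ * t i i k) ^ 2 = 6 * N + 9 * ∑ k, b k ^ 2 := by
    simp [hN, hb]
  calc _ ≤ (5 / 3 * ∫ u : EuclideanSpace ℝ (Fin p), gw (fun _ => 1) u) *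
        (5 / 2 * S ^ 2 * (6 * N + 9 * ∑ k, b k ^ 2)) :=
        mul_le_mul hW hC hC0 (by positivity)
    _ = _ := by rw [hR]; ring

lemma exp_taylor (x : ℝ) : |exp x - 1 - x| ≤ x ^ 2 / 2 * ((2 + exp |x|) / 3) := by
  have h0 : 0 ≤ exp x - 1 - x := by linarith [Real.add_one_le_exp x]
  rw [abs_of_nonneg h0]
  rcases le_total 0 x with hx | hx
  · rw [abs_of_nonneg hx]
    have hm : MonotoneOn (fun y : ℝ => exp (-y) * (1 + y + y ^ 2 / 3) - (1 - y ^ 2 / 6))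
        (Set.Ici 0) := by
      have hd : ∀ y : ℝ, HasDerivAt
          (fun y : ℝ => exp (-y) * (1 + y + y ^ 2 / 3) - (1 - y ^ 2 / 6))
          (y / 3 * (1 - exp (-y) * (1 + y))) y := by
        intro y
        have a1 : HasDerivAt (fun y : ℝ => exp (-y)) (exp (-y) * (-1)) y :=
          (hasDerivAt_neg y).exp
        have a2 : HasDerivAt (fun y : ℝ => 1 + y + y ^ 2 / 3) (1 + 2 * y / 3) y := by
          have := ((hasDerivAt_id y).const_add 1).fun_add (((hasDerivAt_id y).fun_pow 2).div_const 3)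
          simpa using this
        have a3 : HasDerivAt (fun y : ℝ => 1 - y ^ 2 / 6) (-(2 * y / 6)) y := by
          have := (((hasDerivAt_id y).fun_pow 2).div_const 6).const_sub 1
          simpa using this
        have := (a1.fun_mul a2).fun_sub a3
        exact this.congr_deriv (by ring)
      apply monotoneOn_of_deriv_nonneg (convex_Ici 0)
      · exact fun y _ => (hd y).continuousAt.continuousWithinAt
      · exact fun y _ => (hd y).differentiableAt.differentiableWithinAt
      · intro y hy
        rw [(hd y).deriv]
        simp at hy
        have : exp (-y) * (1 + y) ≤ 1 := by
          rw [Real.exp_neg, inv_mul_le_iff₀ (Real.exp_pos y)]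
          linarith [Real.add_one_le_exp y]
        have h3 : 0 ≤ 1 - exp (-y) * (1 + y) := by linarith
        positivity
    have h1 := hm (Set.mem_Ici.2 le_rfl) (Set.mem_Ici.2 hx) hx
    simp at h1
    have h2 : 1 - x ^ 2 / 6 ≤ exp (-x) * (1 + x + x ^ 2 / 3) := by linarith
    rw [Real.exp_neg, le_inv_mul_iff₀ (Real.exp_pos x)] at h2
    linarith
  · have h1 : 1 ≤ exp |x| := Real.one_le_exp (abs_nonneg x)
    have h2 := Real.quadratic_le_exp_of_nonneg (x := -x) (by linarith)
    have h3 : exp x ≤ 1 + x + x ^ 2 / 2 := by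
      have h4 : exp x * exp (-x) = 1 := by rw [← Real.exp_add]; simp
      have h5 : exp x * (1 + -x + (-x) ^ 2 / 2) ≤ 1 := by
        calc exp x * (1 + -x + (-x) ^ 2 / 2) ≤ exp x * exp (-x) :=
              mul_le_mul_of_nonneg_left h2 (Real.exp_pos x).le
          _ = 1 := h4
      have h6 : 0 < 1 + -x + (-x) ^ 2 / 2 := by nlinarith [sq_nonneg x]
      refine le_of_mul_le_mul_right (h5.trans ?_) h6
      nlinarith [sq_nonneg (x ^ 2)]
    nlinarith [sq_nonneg x]

lemma gaussNorm_comp {p : ℕ} (D P : Matrix (Fin p) (Fin p) ℝ) (hD : D.IsHermitian)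
    (lam : Fin p → ℝ) (h : Pᵀ * (D * D) * P = diagonal lam) (x : EuclideanSpace ℝ (Fin p)) :
    gaussNorm D (Matrix.toEuclideanLin P x) ^ 2 = ∑ i, lam i * x i ^ 2 := by
  have hDt : Dᵀ = D := by
    rw [← conjTranspose_eq_transpose_of_trivial]; exact hD
  unfold gaussNorm
  rw [EuclideanSpace.real_norm_sq_eq]
  have e : ∀ i, (Matrix.toEuclideanLin D (Matrix.toEuclideanLin P x)) i =
      (D *ᵥ (P *ᵥ x.ofLp)) i := fun i => by
    simp
  simp only [e]
  have : ∑ i, (D *ᵥ (P *ᵥ x.ofLp)) i ^ 2 = (D *ᵥ (P *ᵥ x.ofLp)) ⬝ᵥ (D *ᵥ (P *ᵥ x.ofLp)) := by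
    simp [dotProduct, sq]
  rw [this, Matrix.dotProduct_mulVec, Matrix.dotProduct_mulVec, ← Matrix.mulVec_transpose,
    ← Matrix.mulVec_transpose, Matrix.mulVec_mulVec, Matrix.mulVec_mulVec, Matrix.mulVec_mulVec,
    hDt, mul_assoc Pᵀ, h]
  simp only [dotProduct, mulVec_diagonal]
  exact Finset.sum_congr rfl fun i _ => by ring

lemma diag_exists {p : ℕ} (DG DV : Matrix (Fin p) (Fin p) ℝ) (hDG : DG.PosDef) (hDV : DV.PosDef)
    (hL : (DG * DG - DV * DV).PosSemidef) :
    ∃ (P : Matrix (Fin p) (Fin p) ℝ) (lam : Fin p → ℝ), IsUnit P.det ∧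
      Pᵀ * (DG * DG) * P = diagonal (fun _ => 1) ∧ Pᵀ * (DV * DV) * P = diagonal lam ∧
      (∀ i, 0 ≤ lam i) ∧ (∀ i, lam i ≤ 1) ∧
      ∑ i, lam i = ((DV * DV) * (DG * DG)⁻¹).trace := by
  have hGt : DGᵀ = DG := by
    rw [← conjTranspose_eq_transpose_of_trivial]; exact hDG.1
  have hVt : DVᵀ = DV := by
    rw [← conjTranspose_eq_transpose_of_trivial]; exact hDV.1
  have hGu : IsUnit DG.det := hDG.det_pos.ne'.isUnit
  have hSt : (DG⁻¹)ᵀ = DG⁻¹ := by rw [Matrix.transpose_nonsing_inv, hGt]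
  have hA : (DG⁻¹ * (DV * DV) * DG⁻¹).IsHermitian := by
    unfold Matrix.IsHermitian
    rw [conjTranspose_eq_transpose_of_trivial]
    simp only [transpose_mul, hSt, hVt, mul_assoc]
  obtain ⟨O, lam, hO, hO', hd⟩ : ∃ (O : Matrix (Fin p) (Fin p) ℝ) (lam : Fin p → ℝ),
      Oᵀ * O = 1 ∧ O * Oᵀ = 1 ∧ Oᵀ * (DG⁻¹ * (DV * DV) * DG⁻¹) * O = diagonal lam := by
    refine ⟨hA.eigenvectorUnitary, hA.eigenvalues, ?_, ?_, ?_⟩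
    · have := Unitary.coe_star_mul_self hA.eigenvectorUnitary
      simpa [star_eq_conjTranspose] using this
    · have := Unitary.coe_mul_star_self hA.eigenvectorUnitary
      simpa [star_eq_conjTranspose] using this
    · have := hA.conjStarAlgAut_star_eigenvectorUnitary
      rw [Unitary.conjStarAlgAut_star_apply] at this
      simpa [star_eq_conjTranspose] using this
  have hPt : (DG⁻¹ * O)ᵀ = Oᵀ * DG⁻¹ := by rw [transpose_mul, hSt]
  have h1 : (DG⁻¹ * O)ᵀ * (DG * DG) * (DG⁻¹ * O) = diagonal (fun _ => 1) := by
    rw [hPt]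
    calc Oᵀ * DG⁻¹ * (DG * DG) * (DG⁻¹ * O) = Oᵀ * ((DG⁻¹ * DG) * ((DG * DG⁻¹) * O)) := by
          simp only [mul_assoc]
      _ = diagonal (fun _ => 1) := by
          rw [Matrix.nonsing_inv_mul _ hGu, Matrix.mul_nonsing_inv _ hGu, one_mul, one_mul, hO,
            diagonal_one]
  have h2 : (DG⁻¹ * O)ᵀ * (DV * DV) * (DG⁻¹ * O) = diagonal lam := by
    rw [hPt, ← hd]; simp only [mul_assoc]
  refine ⟨DG⁻¹ * O, lam, ?_, h1, h2, ?_, ?_, ?_⟩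
  · rw [det_mul]
    refine IsUnit.mul (Matrix.isUnit_nonsing_inv_det _ hGu) ?_
    exact Matrix.isUnit_det_of_left_inverse hO
  · intro i
    have h3 : (DV * (DG⁻¹ * O))ᴴ * (DV * (DG⁻¹ * O)) = diagonal lam := by
      rw [← h2, conjTranspose_eq_transpose_of_trivial, transpose_mul, hVt]
      simp only [mul_assoc]
    have h4 := Matrix.posSemidef_conjTranspose_mul_self (DV * (DG⁻¹ * O))
    rw [h3, Matrix.posSemidef_diagonal_iff] at h4
    exact h4 i
  · intro i
    have h4 := hL.conjTranspose_mul_mul_same (DG⁻¹ * O)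
    rw [conjTranspose_eq_transpose_of_trivial, Matrix.mul_sub, Matrix.sub_mul, h1, h2,
      Matrix.diagonal_sub, Matrix.posSemidef_diagonal_iff] at h4
    linarith [h4 i]
  · rw [← Matrix.trace_diagonal, ← hd, Matrix.trace_mul_comm, ← mul_assoc, ← mul_assoc, hO', one_mul,
      Matrix.mul_inv_rev, Matrix.trace_mul_comm, ← mul_assoc, Matrix.trace_mul_comm]

lemma change_var {p : ℕ} (P : Matrix (Fin p) (Fin p) ℝ) (hP : IsUnit P.det) :
    ∃ c : ℝ, 0 < c ∧ ∀ f : EuclideanSpace ℝ (Fin p) → ℝ,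
      (Integrable (fun x => f (Matrix.toEuclideanLin P x)) → Integrable f) ∧
      ∫ u, f u = c * ∫ x, f (Matrix.toEuclideanLin P x) := by
  have hdet : LinearMap.det (Matrix.toEuclideanLin P) ≠ 0 := by
    rw [Matrix.toEuclideanLin_eq_toLin, LinearMap.det_toLin]
    exact hP.ne_zero
  set e := (LinearEquiv.ofIsUnitDet (f := Matrix.toEuclideanLin P)
    (v := (EuclideanSpace.basisFun (Fin p) ℝ).toBasis)
    (v' := (EuclideanSpace.basisFun (Fin p) ℝ).toBasis)
    (by rw [LinearMap.det_toMatrix]; exact hdet.isUnit)) with he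
  have hee : ∀ x, e x = Matrix.toEuclideanLin P x := fun x => rfl
  set m := e.toContinuousLinearEquiv.toHomeomorph.toMeasurableEquiv with hm
  have hmm : (m : EuclideanSpace ℝ (Fin p) → EuclideanSpace ℝ (Fin p)) =
    Matrix.toEuclideanLin P := rfl
  have hmap : Measure.map m volume =
      ENNReal.ofReal |(LinearMap.det (Matrix.toEuclideanLin P))⁻¹| •
      (volume : Measure (EuclideanSpace ℝ (Fin p))) := by
    rw [hmm]; exact Measure.map_linearMap_addHaar_eq_smul_addHaar _ hdet
  have hd0 : 0 < |(LinearMap.det (Matrix.toEuclideanLin P))⁻¹| := abs_pos.2 (inv_ne_zero hdet)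
  refine ⟨|(LinearMap.det (Matrix.toEuclideanLin P))⁻¹|⁻¹, inv_pos.2 hd0, fun f => ⟨fun h => ?_, ?_⟩⟩
  · have h2 : Integrable f (Measure.map m volume) := by
      rw [MeasureTheory.integrable_map_equiv]
      exact h
    rw [hmap, integrable_smul_measure] at h2
    · exact h2
    · simpa using hd0
    · exact ENNReal.ofReal_ne_top
  · have h2 : ∫ y, f y ∂(Measure.map m volume) = ∫ x, f (m x) :=
      MeasureTheory.integral_map_equiv m f
    rw [hmap, integral_smul_measure, ENNReal.toReal_ofReal hd0.le, smul_eq_mul] at h2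
    rw [hmm] at h2
    rw [← h2, ← mul_assoc, inv_mul_cancel₀ hd0.ne', one_mul]

lemma tri_expand {p : ℕ} (T : EuclideanSpace ℝ (Fin p) →ₗ[ℝ] EuclideanSpace ℝ (Fin p) →ₗ[ℝ]
      EuclideanSpace ℝ (Fin p) →ₗ[ℝ] ℝ) (M : EuclideanSpace ℝ (Fin p) →ₗ[ℝ] EuclideanSpace ℝ (Fin p))
    (x : EuclideanSpace ℝ (Fin p)) :
    T (M x) (M x) (M x) = ∑ i, ∑ j, ∑ k,
      T (M (EuclideanSpace.single i 1)) (M (EuclideanSpace.single j 1))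
        (M (EuclideanSpace.single k 1)) * (x i * x j * x k) := by
  have hx : M x = ∑ i, x i • M (EuclideanSpace.single i 1) := by
    conv_lhs => rw [← (EuclideanSpace.basisFun (Fin p) ℝ).sum_repr x]
    simp [map_sum]
  have h1 : ∀ a b, T (M x) a b = ∑ i, x i * T (M (EuclideanSpace.single i 1)) a b := by
    intro a b
    rw [hx]
    simp only [map_sum, map_smul, LinearMap.sum_apply, LinearMap.smul_apply, smul_eq_mul]
  have h2 : ∀ a b, T a (M x) b = ∑ i, x i * T a (M (EuclideanSpace.single i 1)) b := by
    intro a b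
    rw [hx]
    simp only [map_sum, map_smul, LinearMap.sum_apply, LinearMap.smul_apply, smul_eq_mul]
  have h3 : ∀ a b, T a b (M x) = ∑ i, x i * T a b (M (EuclideanSpace.single i 1)) := by
    intro a b
    rw [hx]
    simp only [map_sum, map_smul, smul_eq_mul]
  rw [h1]
  refine Finset.sum_congr rfl fun i _ => ?_
  rw [h2, Finset.mul_sum]
  refine Finset.sum_congr rfl fun j _ => ?_
  rw [h3, Finset.mul_sum, Finset.mul_sum]
  refine Finset.sum_congr rfl fun k _ => ?_
  ring

lemma tri_meas {p : ℕ} (T : EuclideanSpace ℝ (Fin p) →ₗ[ℝ] EuclideanSpace ℝ (Fin p) →ₗ[ℝ]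
      EuclideanSpace ℝ (Fin p) →ₗ[ℝ] ℝ) : Measurable (fun u => T u u u) := by
  have h := tri_expand T LinearMap.id
  simp only [LinearMap.id_apply] at h
  simp only [h]
  apply Continuous.measurable
  fun_prop

lemma gauss_facts {p : ℕ}
    (DG DV : Matrix (Fin p) (Fin p) ℝ) (hDG : DG.PosDef) (hDV : DV.PosDef)
    (hLoewner : (DG * DG - DV * DV).PosSemidef)
    (ω : ℝ) (hω0 : 0 ≤ ω) (hω : ω ≤ 1 / 3)
    (hωpG : ω * ((DV * DV) * (DG * DG)⁻¹).trace ≤ 2 / 3)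
    (T : EuclideanSpace ℝ (Fin p) →ₗ[ℝ] EuclideanSpace ℝ (Fin p) →ₗ[ℝ]
      EuclideanSpace ℝ (Fin p) →ₗ[ℝ] ℝ)
    (hTsymm : ∀ u v w, T u v w = T v u w ∧ T u v w = T u w v)
    (G E : EuclideanSpace ℝ (Fin p) → ℝ)
    (hG : G = fun u => exp (-(gaussNorm DG u) ^ 2 / 2))
    (hE : E = fun u => exp (ω * (gaussNorm DV u) ^ 2 / 2) * G u) :
    Integrable G ∧ Integrable E ∧ Integrable (fun u => (T u u u) ^ 2 * G u) ∧
    Integrable (fun u => (T u u u) ^ 2 * E u) ∧ Integrable (fun u => gaussNorm DV u ^ 4 * G u) ∧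
    Integrable (fun u => gaussNorm DV u ^ 4 * E u) ∧ 0 < ∫ u, G u ∧
    ∫ u, (T u u u) ^ 2 * E u ≤ 25 / 6 * (1 - ω)⁻¹ ^ 2 * ∫ u, (T u u u) ^ 2 * G u ∧
    ∫ u, gaussNorm DV u ^ 4 * E u ≤ 5 / 3 * (1 - ω)⁻¹ ^ 2 * ∫ u, gaussNorm DV u ^ 4 * G u := by
  obtain ⟨P, lam, hP, h1, h2, l0, l1, ls⟩ := diag_exists DG DV hDG hDV hLoewner
  obtain ⟨c, hc, hcv⟩ := change_var P hP
  rw [← ls] at hωpG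
  have nG := gaussNorm_comp DG P hDG.1 _ h1
  have nV := gaussNorm_comp DV P hDV.1 _ h2
  have nV4 : ∀ x, gaussNorm DV (Matrix.toEuclideanLin P x) ^ 4 = (∑ i, lam i * x i ^ 2) ^ 2 :=
    fun x => by rw [← nV x]; ring
  have hGx : ∀ x, G (Matrix.toEuclideanLin P x) = gw (fun _ => 1) x := fun x => by
    rw [hG]; simp only [nG]; rfl
  have hEx : ∀ x, E (Matrix.toEuclideanLin P x) = gw (fun i => 1 - ω * lam i) x := fun x => by
    rw [hE]; simp only [hGx, nV]
    unfold gw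
    rw [← Real.exp_add]
    congr 1
    simp only [sub_mul, Finset.sum_sub_distrib, Finset.mul_sum, mul_assoc]
    ring
  have hTx := tri_expand T (Matrix.toEuclideanLin P)
  set t : Fin p → Fin p → Fin p → ℝ := fun i j k =>
    T (Matrix.toEuclideanLin P (EuclideanSpace.single i 1))
      (Matrix.toEuclideanLin P (EuclideanSpace.single j 1))
      (Matrix.toEuclideanLin P (EuclideanSpace.single k 1)) with ht
  have t1 : ∀ i j k, t i j k = t j i k := fun i j k => (hTsymm _ _ _).1
  have t2 : ∀ i j k, t i j k = t i k j := fun i j k => (hTsymm _ _ _).2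
  have hTx' : ∀ x, T (Matrix.toEuclideanLin P x) (Matrix.toEuclideanLin P x)
      (Matrix.toEuclideanLin P x) = ∑ i, ∑ j, ∑ k, t i j k * (x i * x j * x k) := hTx
  have hhalf : (0:ℝ) < 1 / 2 := by norm_num
  have b1 : ∀ _ : Fin p, (1:ℝ) / 2 ≤ 1 := fun _ => by norm_num
  have b2 : ∀ i : Fin p, (1:ℝ) / 2 ≤ 1 - ω * lam i := fun i => by
    nlinarith [l0 i, l1 i]
  have iG := list_int (a := fun _ : Fin p => (1:ℝ)) hhalf b1 []
  have iE := list_int (a := fun i : Fin p => 1 - ω * lam i) hhalf b2 []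
  simp only [List.map_nil, List.prod_nil, one_mul] at iG iE
  refine ⟨(hcv _).1 ?_, (hcv _).1 ?_, (hcv _).1 ?_, (hcv _).1 ?_, (hcv _).1 ?_, (hcv _).1 ?_,
    ?_, ?_, ?_⟩
  · simpa only [hGx] using iG
  · simpa only [hEx] using iE
  · simp only [hGx, hTx']; exact (cub_eq hhalf b1 t t1 t2).1
  · simp only [hEx, hTx']; exact (cub_eq hhalf b2 t t1 t2).1
  · simp only [hGx, nV4]; exact (quart_eq hhalf b1 lam).1
  · simp only [hEx, nV4]; exact (quart_eq hhalf b2 lam).1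
  · rw [(hcv _).2]
    simp only [hGx]
    refine mul_pos hc ?_
    unfold gw at iG ⊢
    exact integral_exp_pos iG
  · rw [(hcv _).2, (hcv (fun u => (T u u u) ^ 2 * G u)).2]
    simp only [hGx, hEx, hTx']
    have := mul_le_mul_of_nonneg_left (comp6 ω hω0 hω lam l0 l1 hωpG t t1 t2) hc.le
    linarith
  · rw [(hcv _).2, (hcv (fun u => gaussNorm DV u ^ 4 * G u)).2]
    simp only [hGx, hEx, nV4]
    have := mul_le_mul_of_nonneg_left (comp4 ω hω0 hω lam l0 l1 hωpG) hc.le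
    linarith

lemma pointwise (δ t E κ v : ℝ) (hE : exp |δ| ≤ E)
    (h1 : |δ - t / 6| ≤ 1) (h4 : |δ - t / 6| ≤ κ * v / 24) :
    |exp δ - 1 - t / 6| ≤ κ * v / 24 + (t ^ 2 / 48 + κ * v / 16) * ((2 + E) / 3) := by
  have a := exp_taylor δ
  have b : δ ^ 2 ≤ t ^ 2 / 24 + κ * v / 8 := by
    have b1 : (δ - t / 6) ^ 2 ≤ |δ - t / 6| := by
      rw [← sq_abs]; nlinarith [abs_nonneg (δ - t / 6)]
    nlinarith [sq_nonneg (t / 6 - 2 * (δ - t / 6))]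
  have c : |exp δ - 1 - t / 6| ≤ |exp δ - 1 - δ| + |δ - t / 6| := by
    have := abs_add_le (exp δ - 1 - δ) (δ - t / 6)
    simpa using this
  have d : δ ^ 2 / 2 * ((2 + exp |δ|) / 3) ≤ (t ^ 2 / 48 + κ * v / 16) * ((2 + E) / 3) := by
    have := Real.exp_pos |δ|
    apply mul_le_mul _ _ (by positivity) (by nlinarith [sq_nonneg δ]) <;> linarith
  linarith

theorem stmt_11 (p : ℕ)
    (DG DV : Matrix (Fin p) (Fin p) ℝ) (hDG : DG.PosDef) (hDV : DV.PosDef)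
    (hLoewner : (DG * DG - DV * DV).PosSemidef)
    (pG Z : ℝ) (hpG : pG = ((DV * DV) * (DG * DG)⁻¹).trace)
    (hZ : Z = ∫ u : EuclideanSpace ℝ (Fin p), exp (-(gaussNorm DG u) ^ 2 / 2))
    (F : EuclideanSpace ℝ (Fin p) → ℝ) (hFmeas : Measurable F)
    (U : Set (EuclideanSpace ℝ (Fin p))) (hU : MeasurableSet U)
    (hUsymm : -U = U)
    (ω : ℝ) (hω0 : 0 ≤ ω) (hω : ω ≤ 1 / 3)
    (hδ3 : ∀ u ∈ U, |F u + (gaussNorm DG u) ^ 2 / 2| ≤ ω * (gaussNorm DV u) ^ 2 / 2)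
    (hωpG : ω * pG ≤ 2 / 3)
    (T : EuclideanSpace ℝ (Fin p) →ₗ[ℝ] EuclideanSpace ℝ (Fin p) →ₗ[ℝ]
      EuclideanSpace ℝ (Fin p) →ₗ[ℝ] ℝ)
    (hTsymm : ∀ u v w, T u v w = T v u w ∧ T u v w = T u w v)
    (κ₄ : ℝ) (hκ₄ : 0 ≤ κ₄)
    (hδ4le1 : ∀ u ∈ U, |F u + (gaussNorm DG u) ^ 2 / 2 - T u u u / 6| ≤ 1)
    (hδ4 : ∀ u ∈ U,
      |F u + (gaussNorm DG u) ^ 2 / 2 - T u u u / 6| ≤ κ₄ * (gaussNorm DV u) ^ 4 / 24)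
    (g : EuclideanSpace ℝ (Fin p) → ℝ) (hgmeas : Measurable g)
    (hg : ∀ u, |g u| ≤ 1) (hgeven : ∀ u, g (-u) = g u) :
    |(∫ u in U, exp (F u) * g u) -
        ∫ u in U, exp (-(gaussNorm DG u) ^ 2 / 2) * g u| ≤
      (1 / (16 * (1 - ω) ^ 2) *
        (Z⁻¹ * ∫ u : EuclideanSpace ℝ (Fin p),
          ((T u u u) ^ 2 + 2 * κ₄ * (gaussNorm DV u) ^ 4) *
            exp (-(gaussNorm DG u) ^ 2 / 2))) * Z := by
  obtain ⟨G, hG⟩ : ∃ G : EuclideanSpace ℝ (Fin p) → ℝ,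
    G = fun u => exp (-(gaussNorm DG u) ^ 2 / 2) := ⟨_, rfl⟩
  obtain ⟨E, hE⟩ : ∃ E : EuclideanSpace ℝ (Fin p) → ℝ,
    E = fun u => exp (ω * (gaussNorm DV u) ^ 2 / 2) * G u := ⟨_, rfl⟩
  have hGu : ∀ u, exp (-(gaussNorm DG u) ^ 2 / 2) = G u := fun u => by rw [hG]
  rw [hpG] at hωpG
  obtain ⟨iG, iE, iTG, iTE, iVG, iVE, Gpos, c6, c4⟩ :=
    gauss_facts DG DV hDG hDV hLoewner ω hω0 hω hωpG T hTsymm G E hG hE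
  simp only [hGu] at hZ ⊢
  have hZpos : 0 < Z := by rw [hZ]; exact Gpos
  have hTm := tri_meas T
  have G0 : ∀ u, 0 < G u := fun u => by rw [hG]; exact Real.exp_pos _
  -- the odd part
  have iO : Integrable (fun u => T u u u / 6 * g u * G u) := by
    refine (iG.add iTG).mono ((((hTm.div_const 6).mul hgmeas).aestronglyMeasurable).mul
      iG.aestronglyMeasurable) (Filter.Eventually.of_forall fun u => ?_)
    have e : (G + fun u => (T u u u) ^ 2 * G u) u = (1 + (T u u u) ^ 2) * G u := by
      simp only [Pi.add_apply]; ring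
    rw [e, norm_mul, norm_mul, norm_mul, Real.norm_of_nonneg (by positivity : 0 ≤ 1 + (T u u u) ^ 2)]
    refine mul_le_mul_of_nonneg_right ?_ (norm_nonneg _)
    simp only [Real.norm_eq_abs]
    have h1 := hg u
    have h2 : |T u u u / 6| ≤ 1 + (T u u u) ^ 2 := by
      rw [abs_div, abs_of_pos (by norm_num : (0:ℝ) < 6)]
      nlinarith [sq_nonneg (|T u u u| - 1), sq_abs (T u u u), abs_nonneg (T u u u)]
    calc |T u u u / 6| * |g u| ≤ (1 + (T u u u) ^ 2) * 1 :=
          mul_le_mul h2 h1 (abs_nonneg _) (by positivity)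
      _ = _ := mul_one _
  have hodd : ∫ u in U, T u u u / 6 * g u * G u = 0 := by
    rw [← integral_indicator hU]
    have h := integral_neg_eq_self (U.indicator fun u => T u u u / 6 * g u * G u)
      (volume : Measure (EuclideanSpace ℝ (Fin p)))
    have h2 : ∀ u, U.indicator (fun u => T u u u / 6 * g u * G u) (-u) =
        -U.indicator (fun u => T u u u / 6 * g u * G u) u := by
      intro u
      have hm : -u ∈ U ↔ u ∈ U := by
        rw [← Set.mem_neg, hUsymm]
      have hGe : G (-u) = G u := by
        rw [hG]; simp only [gaussNorm, map_neg, norm_neg]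
      by_cases hu : u ∈ U
      · rw [Set.indicator_of_mem hu, Set.indicator_of_mem (hm.2 hu), hGe, hgeven]
        simp only [map_neg, LinearMap.neg_apply]
        ring
      · rw [Set.indicator_of_notMem hu, Set.indicator_of_notMem (fun h => hu (hm.1 h)), neg_zero]
    simp only [h2, integral_neg] at h
    linarith
  have hFe : ∀ u, exp (F u) = exp (F u + (gaussNorm DG u) ^ 2 / 2) * G u := fun u => by
    rw [hG, ← Real.exp_add]; congr 1; ring
  have iF : IntegrableOn (fun u => exp (F u) * g u) U := by
    refine Integrable.mono (iE.integrableOn (s := U))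
      ((hFmeas.exp.mul hgmeas).aestronglyMeasurable) ?_
    refine (ae_restrict_iff' hU).2 (Filter.Eventually.of_forall fun u hu => ?_)
    have h1 : exp (F u + (gaussNorm DG u) ^ 2 / 2) ≤ exp (ω * (gaussNorm DV u) ^ 2 / 2) :=
      Real.exp_le_exp.2 ((le_abs_self _).trans (hδ3 u hu))
    have h2 : exp (F u) ≤ E u := by
      rw [hFe, hE]; exact mul_le_mul_of_nonneg_right h1 (G0 u).le
    rw [norm_mul, Real.norm_eq_abs, Real.norm_eq_abs, Real.norm_eq_abs, abs_of_pos (Real.exp_pos _)]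
    calc exp (F u) * |g u| ≤ exp (F u) * 1 :=
          mul_le_mul_of_nonneg_left (hg u) (Real.exp_pos _).le
      _ ≤ |E u| := by rw [mul_one]; exact h2.trans (le_abs_self _)
  have iGg : Integrable (fun u => G u * g u) := by
    refine iG.mono (iG.aestronglyMeasurable.mul hgmeas.aestronglyMeasurable)
      (Filter.Eventually.of_forall fun u => ?_)
    rw [norm_mul]
    exact mul_le_of_le_one_right (norm_nonneg _) (hg u)
  have key : (∫ u in U, exp (F u) * g u) - ∫ u in U, G u * g u =
      ∫ u in U, (exp (F u) * g u - G u * g u - T u u u / 6 * g u * G u) := by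
    have iFG : Integrable (fun u => exp (F u) * g u - G u * g u) (volume.restrict U) :=
      Integrable.sub iF iGg.integrableOn
    rw [integral_sub iFG iO.integrableOn, integral_sub iF iGg.integrableOn, hodd,
      sub_zero]
  rw [key]
  obtain ⟨B, hB⟩ : ∃ B : EuclideanSpace ℝ (Fin p) → ℝ, B = fun u =>
    1 / 72 * ((T u u u) ^ 2 * G u) + 1 / 144 * ((T u u u) ^ 2 * E u) +
      κ₄ / 12 * (gaussNorm DV u ^ 4 * G u) + κ₄ / 48 * (gaussNorm DV u ^ 4 * E u) := ⟨_, rfl⟩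
  have iB1 := iTG.const_mul (1 / 72)
  have iB2 := iTE.const_mul (1 / 144)
  have iB3 := iVG.const_mul (κ₄ / 12)
  have iB4 := iVE.const_mul (κ₄ / 48)
  have iB : Integrable B := by
    rw [hB]; exact ((iB1.add iB2).add iB3).add iB4
  have E0 : ∀ u, 0 < E u := fun u => by rw [hE]; exact mul_pos (Real.exp_pos _) (G0 u)
  have B0 : ∀ u, 0 ≤ B u := fun u => by
    rw [hB]
    have := G0 u
    have := E0 u
    positivity
  have step1 : |∫ u in U, (exp (F u) * g u - G u * g u - T u u u / 6 * g u * G u)| ≤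
      ∫ u in U, B u := by
    rw [← Real.norm_eq_abs]
    refine norm_integral_le_of_norm_le iB.integrableOn ?_
    refine (ae_restrict_iff' hU).2 (Filter.Eventually.of_forall fun u hu => ?_)
    have hp := pointwise (F u + (gaussNorm DG u) ^ 2 / 2) (T u u u)
      (exp (ω * (gaussNorm DV u) ^ 2 / 2)) κ₄ (gaussNorm DV u ^ 4)
      (Real.exp_le_exp.2 (hδ3 u hu)) (hδ4le1 u hu) (hδ4 u hu)
    have e1 : exp (F u) * g u - G u * g u - T u u u / 6 * g u * G u =
        (exp (F u + (gaussNorm DG u) ^ 2 / 2) - 1 - T u u u / 6) * G u * g u := by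
      rw [hFe]; ring
    rw [e1, norm_mul, norm_mul, Real.norm_eq_abs, Real.norm_eq_abs, Real.norm_eq_abs,
      abs_of_pos (G0 u)]
    refine (mul_le_of_le_one_right (mul_nonneg (abs_nonneg _) (G0 u).le) (hg u)).trans ?_
    refine (mul_le_mul_of_nonneg_right hp (G0 u).le).trans (le_of_eq ?_)
    rw [hB, hE]
    ring
  have step2 : ∫ u in U, B u ≤ ∫ u, B u :=
    setIntegral_le_integral iB (Filter.Eventually.of_forall B0)
  have step3 : ∫ u, B u = 1 / 72 * (∫ u, (T u u u) ^ 2 * G u) +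
      1 / 144 * (∫ u, (T u u u) ^ 2 * E u) + κ₄ / 12 * (∫ u, gaussNorm DV u ^ 4 * G u) +
      κ₄ / 48 * (∫ u, gaussNorm DV u ^ 4 * E u) := by
    rw [hB, integral_add ((iB1.fun_add iB2).fun_add iB3) iB4, integral_add (iB1.fun_add iB2) iB3,
      integral_add iB1 iB2]
    simp only [integral_const_mul]
  have step4 : ∫ u, ((T u u u) ^ 2 + 2 * κ₄ * gaussNorm DV u ^ 4) * G u =
      (∫ u, (T u u u) ^ 2 * G u) + 2 * κ₄ * ∫ u, gaussNorm DV u ^ 4 * G u := by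
    rw [← integral_const_mul, ← integral_add iTG (iVG.const_mul (2 * κ₄))]
    congr 1
    ext u
    ring
  have m6 : 0 ≤ ∫ u, (T u u u) ^ 2 * G u :=
    integral_nonneg fun u => mul_nonneg (sq_nonneg _) (G0 u).le
  have m4 : 0 ≤ ∫ u, gaussNorm DV u ^ 4 * G u :=
    integral_nonneg fun u => mul_nonneg (by positivity) (G0 u).le
  rw [step4]
  have hs0 : (0:ℝ) < 1 - ω := by linarith
  obtain ⟨s, hs⟩ : ∃ s : ℝ, s = (1 - ω)⁻¹ ^ 2 := ⟨_, rfl⟩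
  have hs1 : 1 ≤ s := by
    rw [hs]
    exact one_le_pow₀ ((one_le_inv₀ hs0).2 (by linarith))
  have hR : ∀ I : ℝ, 1 / (16 * (1 - ω) ^ 2) * (Z⁻¹ * I) * Z = s / 16 * I := by
    intro I
    rw [hs]
    field_simp
  rw [hR]
  refine (step1.trans step2).trans ?_
  rw [step3]
  rw [← hs] at c6 c4
  generalize (∫ u, (T u u u) ^ 2 * G u) = M6 at *
  generalize (∫ u, (T u u u) ^ 2 * E u) = N6 at *
  generalize (∫ u, gaussNorm DV u ^ 4 * G u) = M4 at *
  generalize (∫ u, gaussNorm DV u ^ 4 * E u) = N4 at *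
  have q1 := mul_le_mul_of_nonneg_left c4 hκ₄
  have q2 := mul_nonneg (sub_nonneg.2 hs1) m6
  have q3 := mul_nonneg (sub_nonneg.2 hs1) (mul_nonneg hκ₄ m4)
  have q4 := mul_nonneg hκ₄ m4
  nlinarith
end
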